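/- Let p be a prime, F a field of characteristic p, and A a central simple F-algebra with exp A = p. Let L/F be a cyclic field extension with [L:F] = p. Let n ∈ ℕ and assume λ_p(A_L) ≤ n. Then λ_p(A) ≤ (n+1)·p − 1. -/

import Mathlib

open scoped TensorProduct

/-- A finite-dimensional central simple algebra over a field `F`. -/
def IsCSA (F A : Type) [Field F] [Ring A] [Algebra F A] : Prop :=
  Algebra.IsCentral F A ∧ IsSimpleRing A ∧ FiniteDimensional F A

/-- An `F`-algebra is split if it is isomorphic to a matrix algebra over `F`. -/
def IsSplitAlg (F A : Type) [Field F] [Ring A] [Algebra F A] : Prop :=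
  ∃ n : ℕ, 0 < n ∧ Nonempty (A ≃ₐ[F] Matrix (Fin n) (Fin n) F)

/-- Brauer equivalence of two algebras over a field `F`. -/
def IsBrauerEquiv (F A B : Type) [Field F] [Ring A] [Algebra F A] [Ring B] [Algebra F B] :
    Prop :=
  ∃ n m : ℕ, 0 < n ∧ 0 < m ∧
    Nonempty ((Matrix (Fin n) (Fin n) A) ≃ₐ[F] (Matrix (Fin m) (Fin m) B))

/-- `A` has exponent `e`: `e` is the least positive integer such that the `e`-fold tensor
power of `A` over `F` is split. -/
def HasExponent (F A : Type) [Field F] [Ring A] [Algebra F A] (e : ℕ) : Prop :=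
  0 < e ∧ IsSplitAlg F (⨂[F] _ : Fin e, A) ∧
    ∀ k : ℕ, 0 < k → IsSplitAlg F (⨂[F] _ : Fin k, A) → e ≤ k

/-- `A` has (Schur) index `d`: `A` is isomorphic to a matrix algebra over a division
algebra of dimension `d ^ 2` over `F`. -/
def HasIndex (F A : Type) [Field F] [Ring A] [Algebra F A] (d : ℕ) : Prop :=
  ∃ (D : Type) (_ : DivisionRing D) (_ : Algebra F D) (m : ℕ), 0 < m ∧
    Nonempty (A ≃ₐ[F] Matrix (Fin m) (Fin m) D) ∧ Module.finrank F D = d ^ 2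

/-- The (Schur) index of `A` is at most `d`. -/
def IndexLE (F A : Type) [Field F] [Ring A] [Algebra F A] (d : ℕ) : Prop :=
  ∃ e : ℕ, e ≤ d ∧ HasIndex F A e

/-- `A` is the cyclic (symbol) algebra `[a, b)_{p,F}` of degree `p` in characteristic `p`:
it has dimension `p ^ 2` over `F` and is generated by elements `i`, `j` subject to
`i ^ p - i = a`, `j ^ p = b`, `j * i = (i - 1) * j`. -/
def IsCyclicAlgWith (p : ℕ) (F A : Type) [Field F] [Ring A] [Algebra F A] (a b : F) : Prop :=
  b ≠ 0 ∧ Module.finrank F A = p ^ 2 ∧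
    ∃ i j : A, i ^ p - i = algebraMap F A a ∧ j ^ p = algebraMap F A b ∧
      j * i = (i - 1) * j ∧ Algebra.adjoin F {i, j} = ⊤

/-- `A` is a cyclic algebra of degree `p`, i.e. of the form `[a, b)_{p,F}`. -/
def IsCyclicPAlg (p : ℕ) (F A : Type) [Field F] [Ring A] [Algebra F A] : Prop :=
  ∃ a b : F, IsCyclicAlgWith p F A a b

/-- The `p`-symbol length of `A` is at most `m`: `A` is Brauer equivalent to a tensor
product of at most `m` cyclic `F`-algebras of degree `p`. -/
def SymbolLengthLE (p : ℕ) (F A : Type) [Field F] [Ring A] [Algebra F A] (m : ℕ) : Prop :=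
  ∃ k : ℕ, k ≤ m ∧ ∃ (D : Fin k → Type) (_ : ∀ i, Ring (D i)) (_ : ∀ i, Algebra F (D i)),
    (∀ i, IsCyclicPAlg p F (D i)) ∧ IsBrauerEquiv F A (⨂[F] i, D i)

/-- `M` is a compositum `LK` of `L` and `K` over `F`: it is generated as an `F`-algebra by
the images of `L` and `K`. -/
def IsCompositum (F L K M : Type) [Field F] [Field L] [Field K] [Field M]
    [Algebra F L] [Algebra F K] [Algebra F M] [Algebra L M] [Algebra K M]
    [IsScalarTower F L M] [IsScalarTower F K M] : Prop :=
  (IsScalarTower.toAlgHom F L M).range ⊔ (IsScalarTower.toAlgHom F K M).range = ⊤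

/-- A cyclic algebra of degree `m` over `F`: a central simple `F`-algebra of degree `m`
containing a cyclic field extension of `F` of degree `m` (as a maximal subfield). -/
def IsCyclicAlgebra (F A : Type) [Field F] [Ring A] [Algebra F A] (m : ℕ) : Prop :=
  IsCSA F A ∧ Module.finrank F A = m ^ 2 ∧
  ∃ (L : Type) (_ : Field L) (_ : Algebra F L), IsGalois F L ∧ IsCyclic (L ≃ₐ[F] L) ∧
    Module.finrank F L = m ∧ Nonempty (L →ₐ[F] A)

/-- `L/F` is a `p`-extension: there is a tower of intermediate fields from `F` to `L`
each step of which is a cyclic extension of degree `p`. -/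
def IsPExtension (p : ℕ) (F L : Type) [Field F] [Field L] [Algebra F L] : Prop :=
  ∃ (n : ℕ) (T : Fin (n + 1) → IntermediateField F L),
    T 0 = ⊥ ∧ T (Fin.last n) = ⊤ ∧
    ∀ i : Fin n, ∃ h : T i.castSucc ≤ T i.succ,
      IsGalois (T i.castSucc) (IntermediateField.extendScalars h) ∧
      IsCyclic ((IntermediateField.extendScalars h) ≃ₐ[T i.castSucc]
        (IntermediateField.extendScalars h)) ∧
      Module.finrank (T i.castSucc) (IntermediateField.extendScalars h) = p

/-- `F` is `p`-cyclic reducible: for every central simple `F`-algebra `A` of exponent `p`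
and every purely inseparable extension `K/F` with `K ^ p ⊆ F`, either `A_K` is split, or
there is a separable extension `L/F` of degree `ind (A_K) / p` such that `A_{LK}` is
Brauer equivalent to a cyclic `LK`-algebra of degree `p`. -/
def IsPCyclicReducible (p : ℕ) (F : Type) [Field F] : Prop :=
  ∀ (A : Type) [Ring A] [Algebra F A], IsCSA F A → HasExponent F A p →
  ∀ (K : Type) [Field K] [Algebra F K], IsPurelyInseparable F K →
    (∀ z : K, z ^ p ∈ (algebraMap F K).range) →
    IsSplitAlg K (K ⊗[F] A) ∨
    ∃ d : ℕ, HasIndex K (K ⊗[F] A) (p * d) ∧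
      ∃ (L : Type) (_ : Field L) (_ : Algebra F L), Algebra.IsSeparable F L ∧
        Module.finrank F L = d ∧
        ∃ (M : Type) (_ : Field M) (_ : Algebra F M) (_ : Algebra L M) (_ : Algebra K M)
          (_ : IsScalarTower F L M) (_ : IsScalarTower F K M),
          IsCompositum F L K M ∧
          ∃ (C : Type) (_ : Ring C) (_ : Algebra M C),
            IsCyclicPAlg p M C ∧ IsBrauerEquiv M (M ⊗[F] A) C

/-- `F` is `p`-reducible: for every central simple `F`-algebra `A` of exponent `p`
and every purely inseparable extension `K/F` with `K ^ p ⊆ F`, either `A_K` is split, or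
there is a separable extension `L/F` of degree `ind (A_K) / p` with `ind A_{LK} = p`. -/
def IsPReducible (p : ℕ) (F : Type) [Field F] : Prop :=
  ∀ (A : Type) [Ring A] [Algebra F A], IsCSA F A → HasExponent F A p →
  ∀ (K : Type) [Field K] [Algebra F K], IsPurelyInseparable F K →
    (∀ z : K, z ^ p ∈ (algebraMap F K).range) →
    IsSplitAlg K (K ⊗[F] A) ∨
    ∃ d : ℕ, HasIndex K (K ⊗[F] A) (p * d) ∧
      ∃ (L : Type) (_ : Field L) (_ : Algebra F L), Algebra.IsSeparable F L ∧
        Module.finrank F L = d ∧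
        ∃ (M : Type) (_ : Field M) (_ : Algebra F M) (_ : Algebra L M) (_ : Algebra K M)
          (_ : IsScalarTower F L M) (_ : IsScalarTower F K M),
          IsCompositum F L K M ∧ HasIndex M (M ⊗[F] A) p

open MulOpposite

section CoefficientProjection

variable {F S T : Type*} [Field F] [Ring S] [Algebra F S] [Ring T] [Algebra F T]

/-- A finite-dimensional central simple algebra is Azumaya. -/
theorem isAzumaya_of_central_simple (F S : Type*) [Field F] [Ring S] [Algebra F S]
    [Algebra.IsCentral F S] [IsSimpleRing S] [FiniteDimensional F S] : IsAzumaya F S := by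
  let _ : Module (S ⊗[F] Sᵐᵒᵖ) S := TensorProduct.Algebra.module
  have smul_def (z : S ⊗[F] Sᵐᵒᵖ) (x : S) : z • x = AlgHom.mulLeftRight F S z x := rfl
  have : IsSimpleModule (S ⊗[F] Sᵐᵒᵖ) S := by
    rw [isSimpleModule_iff]
    refine @IsSimpleOrder.mk _ _ _ ?_ fun N => ?_
    · exact ⟨⊥, ⊤, fun h => one_ne_zero (α := S) <| by
        have : (1 : S) ∈ (⊥ : Submodule (S ⊗[F] Sᵐᵒᵖ) S) := h ▸ Submodule.mem_top
        simp at this⟩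
    · have hl (a x : S) (hx : x ∈ N) : a * x ∈ N := by
        simpa [smul_def] using N.smul_mem (a ⊗ₜ[F] (1 : Sᵐᵒᵖ)) hx
      have hr (a x : S) (hx : x ∈ N) : x * a ∈ N := by
        simpa [smul_def] using N.smul_mem ((1 : S) ⊗ₜ[F] op a) hx
      by_cases h : N = ⊥
      · exact Or.inl h
      · right
        obtain ⟨x, hx, hx0⟩ := Submodule.exists_mem_ne_zero_of_ne_bot h
        let I : TwoSidedIdeal S := .mk' N N.zero_mem N.add_mem N.neg_mem
          (fun {a x} hx => hl a x hx) (fun {x a} hx => hr a x hx)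
        have : (1 : S) ∈ I := IsSimpleRing.one_mem_of_ne_zero_mem I hx0
          (by simpa [I] using hx)
        have h1 : (1 : S) ∈ N := by simpa [I] using this
        exact eq_top_iff.2 fun a _ => by simpa using hl a 1 h1
  have hend (g : Module.End (S ⊗[F] Sᵐᵒᵖ) S) : ∃ c : F, ∀ x, g x = c • x := by
    have h1 (a x : S) : g (a * x) = a * g x := by
      simpa [smul_def] using g.map_smul (a ⊗ₜ[F] (1 : Sᵐᵒᵖ)) x
    have h2 (a x : S) : g (x * a) = g x * a := by
      simpa [smul_def] using g.map_smul ((1 : S) ⊗ₜ[F] op a) x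
    have hc : g 1 ∈ Subalgebra.center F S := Subalgebra.mem_center_iff.2 fun b => by
      rw [← h1, ← h2]; simp
    obtain ⟨c, hc⟩ := Algebra.mem_bot.1 (Algebra.IsCentral.out hc)
    refine ⟨c, fun x => ?_⟩
    have := h2 x 1
    rw [one_mul] at this
    rw [this, ← hc, Algebra.smul_def]
  have hsurj : Function.Surjective (AlgHom.mulLeftRight F S) := by
    intro f
    let f' : Module.End (Module.End (S ⊗[F] Sᵐᵒᵖ) S) S :=
      { toFun := f
        map_add' := f.map_add
        map_smul' := fun g x => by
          obtain ⟨c, hc⟩ := hend g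
          simp [Module.End.smul_def, hc] }
    obtain ⟨s, hs⟩ := (inferInstance : FiniteDimensional F S).fg_top
    obtain ⟨r, hr⟩ := jacobson_density f' s
    refine ⟨r, LinearMap.ext_on hs fun x hx => ?_⟩
    exact (hr x hx).symm
  have hdim : Module.finrank F (S ⊗[F] Sᵐᵒᵖ) = Module.finrank F (Module.End F S) := by
    rw [Module.finrank_tensorProduct, Module.finrank_linearMap,
      ← (MulOpposite.opLinearEquiv F (M := S)).finrank_eq]
  exact { bij := ⟨(LinearMap.injective_iff_surjective_of_finrank_eq_finrank
      (f := (AlgHom.mulLeftRight F S).toLinearMap) hdim).2 hsurj, hsurj⟩ }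

/-- The two-sided action of `S ⊗ Sᵐᵒᵖ` on an algebra `T` receiving a homomorphism from `S`. -/
noncomputable def sandwich (ι : S →ₐ[F] T) : S ⊗[F] Sᵐᵒᵖ →ₐ[F] Module.End F T :=
  (AlgHom.mulLeftRight F T).comp (Algebra.TensorProduct.map ι (AlgHom.op ι))

@[simp]
theorem sandwich_tmul (ι : S →ₐ[F] T) (a : S) (b : Sᵐᵒᵖ) (t : T) :
    sandwich ι (a ⊗ₜ b) t = ι a * t * ι b.unop := by
  simp [sandwich]

theorem sandwich_map (ι : S →ₐ[F] T) (z : S ⊗[F] Sᵐᵒᵖ) (s : S) :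
    sandwich ι z (ι s) = ι (AlgHom.mulLeftRight F S z s) := by
  induction z with
  | zero => simp
  | tmul a b => simp
  | add a b ha hb => simp [ha, hb]

theorem sandwich_mul_right (ι : S →ₐ[F] T) {c : T} (hc : ∀ s, ι s * c = c * ι s)
    (z : S ⊗[F] Sᵐᵒᵖ) (t : T) : sandwich ι z (t * c) = sandwich ι z t * c := by
  induction z with
  | zero => simp
  | tmul a b => simp [mul_assoc, hc]
  | add a b ha hb => simp [ha, hb, add_mul]

theorem sandwich_mul_left (ι : S →ₐ[F] T) {c : T} (hc : ∀ s, ι s * c = c * ι s)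
    (z : S ⊗[F] Sᵐᵒᵖ) (t : T) : sandwich ι z (c * t) = c * sandwich ι z t := by
  induction z with
  | zero => simp
  | tmul a b => simp [← mul_assoc, hc]
  | add a b ha hb => simp [ha, hb, mul_add]

theorem sandwich_mem (ι : S →ₐ[F] T) (I : TwoSidedIdeal T) (z : S ⊗[F] Sᵐᵒᵖ) {t : T}
    (ht : t ∈ I) : sandwich ι z t ∈ I := by
  induction z with
  | zero => simp
  | tmul a b => simpa using I.mul_mem_right _ _ (I.mul_mem_left _ _ ht)
  | add a b ha hb => simpa using I.add_mem ha hb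

variable [IsAzumaya F S]

/-- The element of `S ⊗ Sᵐᵒᵖ` acting on `S` as `s ↦ f s • 1`. -/
noncomputable def coeffElement (f : Module.Dual F S) : S ⊗[F] Sᵐᵒᵖ :=
  (AlgEquiv.ofBijective _ (IsAzumaya.bij (R := F) (A := S))).symm (f.smulRight 1)

theorem mulLeftRight_coeffElement (f : Module.Dual F S) :
    AlgHom.mulLeftRight F S (coeffElement f) = f.smulRight 1 :=
  (AlgEquiv.ofBijective _ (IsAzumaya.bij (R := F) (A := S))).apply_symm_apply _

theorem tmul_one_mul_coeffElement (f : Module.Dual F S) (s : S) :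
    (s ⊗ₜ[F] (1 : Sᵐᵒᵖ)) * coeffElement f = ((1 : S) ⊗ₜ[F] op s) * coeffElement f := by
  apply (IsAzumaya.bij (R := F) (A := S)).injective
  rw [map_mul, map_mul, mulLeftRight_coeffElement]
  ext x
  simp

/-- For `T ≅ S ⊗ C`, with `C` the centralizer of `S`, the projection `f ⊗ id` onto `C`. -/
noncomputable def coeffProj (ι : S →ₐ[F] T) (f : Module.Dual F S) : T →ₗ[F] T :=
  sandwich ι (coeffElement f)

theorem coeffProj_comm (ι : S →ₐ[F] T) (f : Module.Dual F S) (t : T) (s : S) :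
    ι s * coeffProj ι f t = coeffProj ι f t * ι s := by
  have := congr($(congr(sandwich ι $(tmul_one_mul_coeffElement f s))) t)
  simpa only [coeffProj, map_mul, Module.End.mul_apply, sandwich_tmul, unop_one, map_one, one_mul,
    mul_one, unop_op] using this

theorem coeffProj_map_mul (ι : S →ₐ[F] T) (f : Module.Dual F S) (s : S) {c : T}
    (hc : ∀ s, ι s * c = c * ι s) : coeffProj ι f (ι s * c) = f s • c := by
  rw [coeffProj, sandwich_mul_right ι hc, sandwich_map, mulLeftRight_coeffElement]
  simp

theorem coeffProj_mul_right (ι : S →ₐ[F] T) (f : Module.Dual F S) (t : T) {c : T}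
    (hc : ∀ s, ι s * c = c * ι s) : coeffProj ι f (t * c) = coeffProj ι f t * c :=
  sandwich_mul_right ι hc _ _

theorem coeffProj_mul_left (ι : S →ₐ[F] T) (f : Module.Dual F S) (t : T) {c : T}
    (hc : ∀ s, ι s * c = c * ι s) : coeffProj ι f (c * t) = c * coeffProj ι f t :=
  sandwich_mul_left ι hc _ _

theorem sum_mul_coeffProj {κ : Type*} [Fintype κ] (b : Module.Basis κ F S) (ι : S →ₐ[F] T)
    (t : T) : ∑ k, ι (b k) * coeffProj ι (b.coord k) t = t := by
  have h : ∑ k, (b k ⊗ₜ[F] (1 : Sᵐᵒᵖ)) * coeffElement (b.coord k) = 1 := by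
    apply (IsAzumaya.bij (R := F) (A := S)).injective
    rw [map_sum, map_one]
    ext x
    simp only [map_mul, mulLeftRight_coeffElement, LinearMap.sum_apply, Module.End.mul_apply,
      LinearMap.smulRight_apply, AlgHom.mulLeftRight_apply, unop_one, mul_one, mul_smul_comm]
    simp [b.sum_repr x]
  have := congr($(congr(sandwich ι $h)) t)
  simpa [coeffProj] using this

/-- Commuting homomorphisms out of an Azumaya algebra and out of an algebra that embeds induce an
injection of the tensor product. -/
theorem injective_lift_of_isAzumaya {C : Type*} [Ring C] [Algebra F C] (ι : S →ₐ[F] T)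
    (j : C →ₐ[F] T) (hj : Function.Injective j) (hc : ∀ s c, Commute (ι s) (j c)) :
    Function.Injective (Algebra.TensorProduct.lift ι j hc) := by
  rw [injective_iff_map_eq_zero]
  intro x hx
  let b := Module.finBasis F S
  obtain ⟨v, rfl⟩ : ∃ v : Fin (Module.finrank F S) → C, x = ∑ k, b k ⊗ₜ v k := by
    obtain ⟨v, hv⟩ := TensorProduct.eq_repr_basis_left b x
    refine ⟨v, ?_⟩
    rw [← hv, Finsupp.sum_fintype]
    simp
  have key (k) : v k = 0 := by
    apply hj
    have := congr(coeffProj ι (b.coord k) $hx)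
    rw [map_sum, map_sum, map_zero] at this
    rw [map_zero, ← this, Finset.sum_eq_single k]
    · rw [Algebra.TensorProduct.lift_tmul, coeffProj_map_mul ι _ _ fun s => (hc s _).eq]
      simp
    · intro l _ hl
      rw [Algebra.TensorProduct.lift_tmul, coeffProj_map_mul ι _ _ fun s => (hc s _).eq]
      simp [hl]
    · simp
  simp [key]

/-- The centralizer theorem: an algebra is the tensor product of an Azumaya subalgebra and its
centralizer. -/
noncomputable def tensorCentralizerEquiv (ι : S →ₐ[F] T) :
    S ⊗[F] Subalgebra.centralizer F (ι.range : Set T) ≃ₐ[F] T :=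
  AlgEquiv.ofBijective
    (Algebra.TensorProduct.lift ι (Subalgebra.centralizer F (ι.range : Set T)).val
      fun s c => (Subalgebra.mem_centralizer_iff F).1 c.2 _ (ι.mem_range_self s)) <| by
    refine ⟨injective_lift_of_isAzumaya _ _ Subtype.val_injective _, fun t => ?_⟩
    let b := Module.finBasis F S
    refine ⟨∑ k, b k ⊗ₜ ⟨coeffProj ι (b.coord k) t, (Subalgebra.mem_centralizer_iff F).2 ?_⟩, ?_⟩
    · rintro _ ⟨s, rfl⟩
      exact coeffProj_comm ι _ t s
    · rw [map_sum]
      exact (Finset.sum_congr rfl fun k _ => Algebra.TensorProduct.lift_tmul _ _ _ _ _).trans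
        (sum_mul_coeffProj b ι t)

/-- Derivations of an Azumaya algebra with values in an algebra over it are inner. -/
theorem exists_inner_of_isAzumaya [Nontrivial S] (ι : S →ₐ[F] T) (d : S →ₗ[F] T)
    (hd : ∀ s t, d (s * t) = ι s * d t + d s * ι t) : ∃ m : T, ∀ s, ι s * m - m * ι s = d s := by
  obtain ⟨f, hf⟩ := Module.Projective.exists_dual_eq_one F (one_ne_zero (α := S))
  let D : S ⊗[F] Sᵐᵒᵖ →ₗ[F] T := TensorProduct.lift
    (((LinearMap.mul F T).comp ι.toLinearMap).compl₂
      (d.comp (MulOpposite.opLinearEquiv F).symm.toLinearMap))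
  have hD (a : S) (b : Sᵐᵒᵖ) : D (a ⊗ₜ b) = ι a * d b.unop := rfl
  have h1 (z : S ⊗[F] Sᵐᵒᵖ) (s : S) : D ((s ⊗ₜ[F] (1 : Sᵐᵒᵖ)) * z) = ι s * D z := by
    induction z with
    | zero => simp
    | tmul a b => simp [hD, mul_assoc]
    | add a b ha hb => simp [ha, hb, mul_add]
  have h2 (z : S ⊗[F] Sᵐᵒᵖ) (s : S) : D (((1 : S) ⊗ₜ[F] op s) * z) =
      ι (AlgHom.mulLeftRight F S z 1) * d s + D z * ι s := by
    induction z with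
    | zero => simp
    | tmul a b => simp [hD, mul_assoc, hd, mul_add]
    | add a b ha hb => simp only [mul_add, map_add, ha, hb, add_mul, LinearMap.add_apply]; abel
  refine ⟨D (coeffElement f), fun s => ?_⟩
  rw [← h1, tmul_one_mul_coeffElement, h2, mulLeftRight_coeffElement]
  simp [hf]

end CoefficientProjection

section BaseChange

variable {F : Type*} [Field F] (E : Type*) [Field E] [Algebra F E]
  {S : Type*} [Ring S] [Algebra F S] [IsAzumaya F S]

theorem coeffProj_includeRight_mem_bot (f : Module.Dual F S) (t : E ⊗[F] S) :
    coeffProj (Algebra.TensorProduct.includeRight : S →ₐ[F] E ⊗[F] S) f t ∈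
      (⊥ : Subalgebra E (E ⊗[F] S)) := by
  induction t with
  | zero => simp
  | add a b ha hb => rw [map_add]; exact add_mem ha hb
  | tmul e s =>
    have : e ⊗ₜ[F] s = Algebra.TensorProduct.includeRight s * (e ⊗ₜ[F] (1 : S)) := by simp
    rw [this, coeffProj_map_mul _ _ _ fun s => by simp]
    exact Algebra.mem_bot.2 ⟨f s • e, by simp [TensorProduct.smul_tmul']⟩

theorem isCentral_baseChange [Nontrivial S] : Algebra.IsCentral E (E ⊗[F] S) where
  out z hz := by
    obtain ⟨f, hf⟩ := Module.Projective.exists_dual_eq_one F (one_ne_zero (α := S))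
    have := coeffProj_map_mul (Algebra.TensorProduct.includeRight : S →ₐ[F] E ⊗[F] S) f 1
      (c := z) fun s => Subalgebra.mem_center_iff.1 hz _
    rw [map_one, one_mul, hf, one_smul] at this
    rw [← this]
    exact coeffProj_includeRight_mem_bot E f z

theorem isSimpleRing_baseChange [Nontrivial S] : IsSimpleRing (E ⊗[F] S) where
  simple := by
    have : Nontrivial (E ⊗[F] S) := Module.FaithfullyFlat.lTensor_nontrivial F E S
    refine { exists_pair_ne := ⟨⊥, ⊤, bot_ne_top⟩, eq_bot_or_eq_top := fun I => ?_ }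
    rw [or_iff_not_imp_left]
    intro hI
    obtain ⟨x, hx, hx0⟩ : ∃ x ∈ I, x ≠ 0 := by
      by_contra! h
      exact hI (eq_bot_iff.2 fun x hx => by simpa using h x hx)
    let b := Module.finBasis F S
    obtain ⟨k, hk⟩ : ∃ k, coeffProj (Algebra.TensorProduct.includeRight : S →ₐ[F] E ⊗[F] S)
        (b.coord k) x ≠ 0 := by
      by_contra! h
      have := sum_mul_coeffProj b (Algebra.TensorProduct.includeRight : S →ₐ[F] E ⊗[F] S) x
      simp [h] at this
      exact hx0 this.symm
    obtain ⟨e, he⟩ := Algebra.mem_bot.1 (coeffProj_includeRight_mem_bot E (b.coord k) x)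
    have hmem : algebraMap E (E ⊗[F] S) e ∈ I := by rw [he]; exact sandwich_mem _ I _ hx
    have he0 : e ≠ 0 := by rintro rfl; simp at he; exact hk he.symm
    have : (1 : E ⊗[F] S) ∈ I := by
      have := I.mul_mem_left (algebraMap E (E ⊗[F] S) e⁻¹) _ hmem
      rwa [← map_mul, inv_mul_cancel₀ he0, map_one] at this
    exact eq_top_iff.2 fun y _ => by simpa using I.mul_mem_left y _ this

end BaseChange

section Splitting

variable {F E : Type*} [Field F] [Field E] [Algebra F E]
  {A : Type*} [Ring A] [Algebra F A]
  {ι : Type*} [Fintype ι] [DecidableEq ι]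

/-- The extension of a homomorphism to the scalar extension of its domain. -/
noncomputable def baseChangeLift {R : Type*} [Ring R] [Algebra F R] [Algebra E R]
    [IsScalarTower F E R] (φ : A →ₐ[F] R) : E ⊗[F] A →ₐ[E] R :=
  Algebra.TensorProduct.lift (Algebra.ofId E R) φ
    fun e a => Algebra.commute_algebraMap_left e (φ a)

@[simp]
theorem baseChangeLift_tmul {R : Type*} [Ring R] [Algebra F R] [Algebra E R]
    [IsScalarTower F E R] (φ : A →ₐ[F] R) (e : E) (a : A) :
    baseChangeLift φ (e ⊗ₜ a) = e • φ a :=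
  (Algebra.TensorProduct.lift_tmul _ _ _ _ _).trans (Algebra.smul_def e (φ a)).symm

theorem baseChangeLift_injective [IsAzumaya F A] {R : Type*} [Ring R] [Algebra F R] [Algebra E R]
    [IsScalarTower F E R] [Nontrivial R] (φ : A →ₐ[F] R) :
    Function.Injective (baseChangeLift (E := E) φ) := by
  have hc (a : A) (e : E) : Commute (φ a) (IsScalarTower.toAlgHom F E R e) :=
    Algebra.commute_algebraMap_right e (φ a)
  have h := injective_lift_of_isAzumaya φ (IsScalarTower.toAlgHom F E R)
    (algebraMap E R).injective hc
  have h2 := h.comp (Algebra.TensorProduct.comm F E A).injective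
  convert h2 using 1
  ext x
  induction x with
  | zero => simp
  | add a b ha hb => simp only [map_add, ha, hb, Function.comp_apply]
  | tmul e s => simp [Algebra.smul_def, Algebra.commutes]

theorem baseChangeLift_bijective [IsAzumaya F A] [Nonempty ι]
    (hdim : Fintype.card ι ^ 2 = Module.finrank F A)
    (φ : A →ₐ[F] Matrix ι ι E) : Function.Bijective (baseChangeLift (E := E) φ) := by
  have hinj := baseChangeLift_injective (E := E) φ
  refine ⟨hinj, ?_⟩
  refine (LinearMap.injective_iff_surjective_of_finrank_eq_finrank
    (f := (baseChangeLift (E := E) φ).toLinearMap) ?_).1 hinj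
  rw [Module.finrank_baseChange, Module.finrank_matrix, ← hdim]
  simp [sq]

/-- Skolem–Noether for absolutely irreducible matrix representations. -/
theorem exists_conj_of_algHom_matrix [IsAzumaya F A] [Nonempty ι]
    (hdim : Fintype.card ι ^ 2 = Module.finrank F A) (φ ψ : A →ₐ[F] Matrix ι ι E) :
    ∃ g : (Matrix ι ι E)ˣ, ∀ a, φ a = g * ψ a * (g⁻¹ : (Matrix ι ι E)ˣ) := by
  let e₁ := AlgEquiv.ofBijective _ (baseChangeLift_bijective hdim φ)
  let e₂ := AlgEquiv.ofBijective _ (baseChangeLift_bijective hdim ψ)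
  let θ := e₂.symm.trans e₁
  obtain ⟨T, hT⟩ := AlgEquiv.eq_linearEquivConjAlgEquiv
    ((Matrix.toLinAlgEquiv' (R := E) (n := ι)).symm.trans (θ.trans Matrix.toLinAlgEquiv'))
  have hTT : T.toLinearMap * T.symm.toLinearMap = 1 := by ext; simp
  have hTT' : T.symm.toLinearMap * T.toLinearMap = 1 := by ext; simp
  let g : (Matrix ι ι E)ˣ :=
    ⟨LinearMap.toMatrixAlgEquiv' T.toLinearMap, LinearMap.toMatrixAlgEquiv' T.symm.toLinearMap,
      by rw [← map_mul, hTT, map_one], by rw [← map_mul, hTT', map_one]⟩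
  refine ⟨g, fun a => ?_⟩
  have h1 : θ (ψ a) = φ a := by
    have h2 : e₂ (1 ⊗ₜ a) = ψ a := by simp [e₂]
    have h3 : e₁ (1 ⊗ₜ a) = φ a := by simp [e₁]
    rw [← h2, ← h3]
    simp [θ]
  have h4 := congr($hT (Matrix.toLinAlgEquiv' (ψ a)))
  simp only [AlgEquiv.trans_apply, AlgEquiv.symm_apply_apply, h1] at h4
  apply (Matrix.toLinAlgEquiv' (R := E) (n := ι)).injective
  rw [h4, map_mul, map_mul]
  have h5 : Matrix.toLinAlgEquiv' (g : Matrix ι ι E) = T.toLinearMap := by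
    simp [g]
  have h6 : Matrix.toLinAlgEquiv' ((g⁻¹ : (Matrix ι ι E)ˣ) : Matrix ι ι E) =
    T.symm.toLinearMap := by
    simp [g]
  rw [h5, h6]
  ext
  simp [LinearEquiv.conjAlgEquiv]

end Splitting

section SymbolPair

open Polynomial

/-- Generators of a cyclic algebra of degree `p` in characteristic `p`. -/
structure IsSymbolPair (p : ℕ) {F T : Type*} [Field F] [Ring T] [Algebra F T] (x y : T) (a b : F) :
    Prop where
  ne_zero : b ≠ 0
  pow_sub : x ^ p - x = algebraMap F T a
  pow_eq : y ^ p = algebraMap F T b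
  mul_eq : y * x = (x - 1) * y

theorem eq_C_of_comp_sub_one {p : ℕ} {F : Type*} [Field F] [CharP F p] {f : F[X]}
    (hn : f.natDegree < p) (hper : f.comp (X - 1) = f) : f = C (f.eval 0) := by
  have hroot (k : ℕ) : f.eval (k : F) = f.eval 0 := by
    induction k with
    | zero => simp
    | succ k ih =>
      have := congr(eval ((k : F) + 1) $hper)
      rw [eval_comp] at this
      simpa [ih] using this.symm
  exact eq_of_natDegree_lt_card_of_eval_eq f (C (f.eval 0)) (f := fun k : Fin p => ((k : ℕ) : F))
    (fun k l hkl => Fin.ext (CharP.natCast_injOn_Iio F p k.2 l.2 hkl))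
    (fun k => by simpa using hroot k) (by simpa using hn)

namespace IsSymbolPair

variable {p : ℕ} {F T : Type*} [Field F] [Ring T] [Algebra F T] {x y : T} {a b : F}

theorem mul_aeval (h : IsSymbolPair p x y a b) (f : F[X]) :
    y * aeval x f = aeval x (f.comp (X - 1)) * y := by
  have h1 (n : ℕ) : y * x ^ n = (x - 1) ^ n * y := (SemiconjBy.pow_right h.mul_eq n).eq
  induction f using Polynomial.induction_on' with
  | add f g hf hg => simp [mul_add, add_mul, hf, hg]
  | monomial n c =>
    rw [← C_mul_X_pow_eq_monomial]
    simp only [map_mul, aeval_C, map_pow, aeval_X, mul_comp, C_comp, X_pow_comp, map_sub, map_one]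
    rw [Algebra.left_comm, h1, mul_assoc]

theorem pow_mul (h : IsSymbolPair p x y a b) (k : ℕ) : y ^ k * x = (x - k) * y ^ k := by
  induction k with
  | zero => simp
  | succ k ih =>
    rw [pow_succ, mul_assoc, h.mul_eq, ← mul_assoc, mul_sub, ih]
    push_cast
    noncomm_ring

theorem commutator_aeval_mul_pow (h : IsSymbolPair p x y a b) (f : F[X]) (l : ℕ) :
    x * (aeval x f * y ^ l) - aeval x f * y ^ l * x = (l : F) • (aeval x f * y ^ l) := by
  have hc : x * aeval x f = aeval x f * x := by
    conv_lhs => enter [1]; rw [← aeval_X (R := F) x]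
    conv_rhs => enter [2]; rw [← aeval_X (R := F) x]
    rw [← map_mul, ← map_mul, mul_comm]
  rw [mul_assoc _ _ x, h.pow_mul, sub_mul, mul_sub, ← mul_assoc, hc, mul_assoc, sub_sub_cancel,
    Algebra.smul_def, map_natCast, ← mul_assoc, ← Nat.cast_comm, mul_assoc]

theorem mem_of_mul_pow_mem (h : IsSymbolPair p x y a b) {J : Submodule F T}
    (hyr : ∀ t ∈ J, t * y ∈ J) {t : T} {k : ℕ} (hk : k ≤ p) (ht : t * y ^ k ∈ J) : t ∈ J := by
  have h1 (n : ℕ) : t * y ^ k * y ^ n ∈ J := by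
    induction n with
    | zero => simpa
    | succ n ih => rw [pow_succ, ← mul_assoc]; exact hyr _ ih
  have h2 := h1 (p - k)
  rw [mul_assoc, ← pow_add, Nat.add_sub_cancel' hk, h.pow_eq, ← Algebra.commutes,
    ← Algebra.smul_def] at h2
  simpa [smul_smul, inv_mul_cancel₀ h.ne_zero] using J.smul_mem b⁻¹ h2

theorem sum_smul_eq_sum_aeval (c : Fin p × Fin p → F) :
    ∑ k, c k • (x ^ (k.1 : ℕ) * y ^ (k.2 : ℕ)) = ∑ m : Fin p,
      aeval x (∑ n : Fin p, C (c (n, m)) * X ^ (n : ℕ)) * y ^ (m : ℕ) := by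
  rw [Fintype.sum_prod_type_right]
  refine Finset.sum_congr rfl fun m _ => ?_
  simp [Finset.sum_mul, Algebra.smul_def, mul_assoc]

variable [hp : Fact p.Prime]

theorem eq_zero_of_aeval_mem [CharP F p] (h : IsSymbolPair p x y a b) {J : Submodule F T}
    (hyl : ∀ t ∈ J, y * t ∈ J) (hyr : ∀ t ∈ J, t * y ∈ J) (h1 : (1 : T) ∉ J) (n : ℕ) :
    ∀ f : F[X], f.natDegree = n → n < p → aeval x f ∈ J → f = 0 := by
  induction n using Nat.strong_induction_on with
  | _ n ih =>
  intro f hf hn hJ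
  have hq : (X - 1 : F[X]).natDegree = 1 := natDegree_X_sub_C 1
  have hlc : (X - 1 : F[X]).leadingCoeff = 1 := leadingCoeff_X_sub_C 1
  have hmem : aeval x (f.comp (X - 1)) ∈ J :=
    h.mem_of_mul_pow_mem hyr hp.out.one_le (by rw [pow_one, ← h.mul_aeval]; exact hyl _ hJ)
  have hdeg : (f.comp (X - 1)).natDegree = f.natDegree := by rw [natDegree_comp, hq, mul_one]
  have hper : f.comp (X - 1) = f := by
    by_contra hne
    by_cases hn0 : n = 0
    · rw [eq_C_of_natDegree_eq_zero (hf.trans hn0)] at hne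
      simp at hne
    have hf0 : f ≠ 0 := by rintro rfl; simp at hf; exact hn0 hf.symm
    have hlt : (f.comp (X - 1) - f).natDegree < n := by
      have : (f.comp (X - 1) - f).degree < (f.comp (X - 1)).degree := by
        refine degree_sub_lt_left ?_ ?_ ?_
        · have : f.comp (X - 1) ≠ 0 := by
            intro h0; rw [h0, natDegree_zero, hf] at hdeg; exact hn0 hdeg.symm
          rw [degree_eq_natDegree this, degree_eq_natDegree hf0, hdeg]
        · intro h0; rw [h0, natDegree_zero, hf] at hdeg; exact hn0 hdeg.symm
        · rw [leadingCoeff_comp (by rw [hq]; exact one_ne_zero), hlc]; simp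
      have h3 := natDegree_lt_natDegree (sub_ne_zero.2 hne) this
      rwa [hdeg, hf] at h3
    exact hne (sub_eq_zero.1 (ih _ hlt _ rfl (hlt.trans hn) (by rw [map_sub]; exact sub_mem hmem hJ)))
  have hC := eq_C_of_comp_sub_one (hf ▸ hn) hper
  rw [hC, aeval_C] at hJ
  by_contra hf0
  have hc : f.eval 0 ≠ 0 := fun h0 => hf0 (by rw [hC, h0, map_zero])
  apply h1
  have := J.smul_mem (f.eval 0)⁻¹ hJ
  rwa [Algebra.smul_def, ← map_mul, inv_mul_cancel₀ hc, map_one] at this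

theorem coeff_eq_zero_of_sum_mem [CharP F p] (h : IsSymbolPair p x y a b) {J : Submodule F T}
    (hxl : ∀ t ∈ J, x * t ∈ J) (hxr : ∀ t ∈ J, t * x ∈ J)
    (hyl : ∀ t ∈ J, y * t ∈ J) (hyr : ∀ t ∈ J, t * y ∈ J) (h1 : (1 : T) ∉ J) (f : Fin p → F[X])
    (hf : ∀ k, (f k).natDegree < p) (hJ : ∑ k, aeval x (f k) * y ^ (k : ℕ) ∈ J) (k : Fin p) :
    f k = 0 := by
  let ad : Module.End F T := LinearMap.mulLeft F x - LinearMap.mulRight F x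
  have hev (l : Fin p) :
      ad (aeval x (f l) * y ^ (l : ℕ)) = ((l : ℕ) : F) • (aeval x (f l) * y ^ (l : ℕ)) :=
    h.commutator_aeval_mul_pow (f l) l
  have hpoly (P : F[X]) (t : T) (ht : t ∈ J) : aeval ad P t ∈ J := by
    induction P using Polynomial.induction_on generalizing t with
    | C c => simpa [Module.algebraMap_end_apply] using J.smul_mem c ht
    | add P Q hP hQ => simpa using J.add_mem (hP t ht) (hQ t ht)
    | monomial n c ih =>
      rw [pow_succ, ← mul_assoc, map_mul, aeval_X]
      exact ih _ (sub_mem (hxl t ht) (hxr t ht))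
  have haev (P : F[X]) (l : Fin p) : aeval ad P (aeval x (f l) * y ^ (l : ℕ)) =
      P.eval ((l : ℕ) : F) • (aeval x (f l) * y ^ (l : ℕ)) := by
    induction P using Polynomial.induction_on with
    | C c => simp [Module.algebraMap_end_apply]
    | add P Q hP hQ => simp [hP, hQ, add_smul]
    | monomial n c ih =>
      rw [pow_succ, ← mul_assoc, map_mul (aeval ad), aeval_X, Module.End.mul_apply, hev, map_smul,
        ih, smul_smul, eval_mul_X, mul_comm]
  have hinj : Function.Injective fun l : Fin p => ((l : ℕ) : F) :=
    fun k l hkl => Fin.ext (CharP.natCast_injOn_Iio F p k.2 l.2 hkl)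
  have hk : aeval x (f k) * y ^ (k : ℕ) ∈ J := by
    have := hpoly (Lagrange.basis Finset.univ (fun l : Fin p => ((l : ℕ) : F)) k) _ hJ
    rw [map_sum, Finset.sum_eq_single k, haev] at this
    · rwa [Lagrange.eval_basis_self hinj.injOn (Finset.mem_univ k), one_smul] at this
    · intro l _ hl
      rw [haev, Lagrange.eval_basis_of_ne (v := fun l : Fin p => ((l : ℕ) : F)) hl.symm
        (Finset.mem_univ l), zero_smul]
    · simp
  exact h.eq_zero_of_aeval_mem hyl hyr h1 _ _ rfl (hf k) (h.mem_of_mul_pow_mem hyr k.2.le hk)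

theorem pow_mul_pow_mem_span (h : IsSymbolPair p x y a b) (n m : ℕ) :
    x ^ n * y ^ m ∈ Submodule.span F (Set.range fun k : Fin p × Fin p =>
      x ^ (k.1 : ℕ) * y ^ (k.2 : ℕ)) := by
  induction m using Nat.strong_induction_on with
  | _ m ihm =>
  by_cases hm : m < p
  · clear ihm
    induction n using Nat.strong_induction_on with
    | _ n ihn =>
    by_cases hn : n < p
    · exact Submodule.subset_span ⟨(⟨n, hn⟩, ⟨m, hm⟩), rfl⟩
    · obtain ⟨n, rfl⟩ := Nat.exists_eq_add_of_le (not_lt.1 hn)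
      have : x ^ (p + n) * y ^ m = x ^ (n + 1) * y ^ m + a • (x ^ n * y ^ m) := by
        rw [pow_add, ← sub_add_cancel (x ^ p) x, h.pow_sub, add_mul, add_mul, ← pow_succ',
          Algebra.smul_def, ← mul_assoc, add_comm]
      rw [this]
      exact add_mem (ihn _ (by have := hp.out.two_le; omega))
        (Submodule.smul_mem _ _ (ihn _ (by have := hp.out.two_le; omega)))
  · obtain ⟨m, rfl⟩ := Nat.exists_eq_add_of_le (not_lt.1 hm)
    have : x ^ n * y ^ (p + m) = b • (x ^ n * y ^ m) := by
      rw [pow_add, h.pow_eq, Algebra.left_comm, Algebra.smul_def]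
    rw [this]
    exact Submodule.smul_mem _ _ (ihm _ (by have := hp.out.pos; omega))

theorem adjoin_eq_span (h : IsSymbolPair p x y a b) :
    Subalgebra.toSubmodule (Algebra.adjoin F {x, y}) = Submodule.span F
      (Set.range fun k : Fin p × Fin p => x ^ (k.1 : ℕ) * y ^ (k.2 : ℕ)) := by
  set W := Submodule.span F (Set.range fun k : Fin p × Fin p => x ^ (k.1 : ℕ) * y ^ (k.2 : ℕ))
  have hpoly (f : F[X]) (m : ℕ) : aeval x f * y ^ m ∈ W := by
    rw [aeval_eq_sum_range, Finset.sum_mul]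
    exact sum_mem fun k _ => by
      rw [smul_mul_assoc]; exact W.smul_mem _ (h.pow_mul_pow_mem_span k m)
  apply le_antisymm
  · have hxy (z : T) (hz : z ∈ ({x, y} : Set T)) (t : T) (ht : t ∈ W) : z * t ∈ W := by
      induction ht using Submodule.span_induction with
      | zero => simp
      | add s t _ _ hs ht => rw [mul_add]; exact add_mem hs ht
      | smul c t _ ht => rw [mul_smul_comm]; exact W.smul_mem _ ht
      | mem t ht =>
        obtain ⟨k, rfl⟩ := ht
        rcases hz with rfl | rfl
        · simp only [← mul_assoc, ← pow_succ']
          exact h.pow_mul_pow_mem_span _ _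
        · have := h.mul_aeval (X ^ (k.1 : ℕ))
          simp only [map_pow, aeval_X] at this
          simp only [← mul_assoc]
          rw [this, mul_assoc, ← pow_succ']
          exact hpoly _ _
    intro t ht
    have key : ∀ w ∈ W, t * w ∈ W := by
      induction ht using Algebra.adjoin_induction with
      | mem z hz => exact hxy z hz
      | algebraMap c => intro w hw; rw [← Algebra.smul_def]; exact W.smul_mem _ hw
      | add s t _ _ hs ht => intro w hw; rw [add_mul]; exact add_mem (hs w hw) (ht w hw)
      | mul s t _ _ hs ht => intro w hw; rw [mul_assoc]; exact hs _ (ht w hw)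
    simpa using key 1 (by simpa using h.pow_mul_pow_mem_span 0 0)
  · refine Submodule.span_le.2 ?_
    rintro _ ⟨k, rfl⟩
    exact mul_mem (S := Subalgebra F T) (pow_mem (Algebra.subset_adjoin (by simp)) _)
      (pow_mem (Algebra.subset_adjoin (by simp)) _)

theorem natDegree_sum_C_mul_X_pow_lt (c : Fin p × Fin p → F) (m : Fin p) :
    (∑ n : Fin p, C (c (n, m)) * X ^ (n : ℕ)).natDegree < p := by
  refine (natDegree_sum_le_of_forall_le _ _ (n := p - 1) fun n _ => ?_).trans_lt
    (Nat.sub_lt hp.out.pos one_pos)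
  exact (natDegree_C_mul_X_pow_le _ _).trans (by omega)

theorem coeff_eq_zero_of_sum_mem' [CharP F p] (h : IsSymbolPair p x y a b) {J : Submodule F T}
    (hxl : ∀ t ∈ J, x * t ∈ J) (hxr : ∀ t ∈ J, t * x ∈ J)
    (hyl : ∀ t ∈ J, y * t ∈ J) (hyr : ∀ t ∈ J, t * y ∈ J) (h1 : (1 : T) ∉ J)
    (c : Fin p × Fin p → F) (hJ : ∑ k, c k • (x ^ (k.1 : ℕ) * y ^ (k.2 : ℕ)) ∈ J)
    (k : Fin p × Fin p) : c k = 0 := by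
  rw [sum_smul_eq_sum_aeval] at hJ
  have := h.coeff_eq_zero_of_sum_mem hxl hxr hyl hyr h1 _ (natDegree_sum_C_mul_X_pow_lt c) hJ k.2
  have := congr(coeff $this k.1)
  simpa [finsetSum_coeff, coeff_X_pow, Fin.val_inj] using this

theorem linearIndependent [CharP F p] [Nontrivial T] (h : IsSymbolPair p x y a b) :
    LinearIndependent F fun k : Fin p × Fin p => x ^ (k.1 : ℕ) * y ^ (k.2 : ℕ) :=
  Fintype.linearIndependent_iff.2 fun c hc => h.coeff_eq_zero_of_sum_mem' (J := ⊥)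
    (by simp) (by simp) (by simp) (by simp) (by simp) c (by simpa using hc)

theorem finrank_adjoin [CharP F p] [Nontrivial T] (h : IsSymbolPair p x y a b) :
    Module.finrank F (Algebra.adjoin F {x, y}) = p ^ 2 := by
  have := finrank_span_eq_card h.linearIndependent
  rw [← h.adjoin_eq_span] at this
  simpa [sq] using this

theorem exists_eq_sum (h : IsSymbolPair p x y a b) (htop : Algebra.adjoin F {x, y} = ⊤) (t : T) :
    ∃ c : Fin p × Fin p → F, t = ∑ k, c k • (x ^ (k.1 : ℕ) * y ^ (k.2 : ℕ)) := by
  have ht : t ∈ Subalgebra.toSubmodule (Algebra.adjoin F {x, y}) := by simp [htop]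
  rw [h.adjoin_eq_span, Submodule.mem_span_range_iff_exists_fun] at ht
  obtain ⟨c, hc⟩ := ht
  exact ⟨c, hc.symm⟩

theorem isSimpleRing [CharP F p] [Nontrivial T] (h : IsSymbolPair p x y a b)
    (htop : Algebra.adjoin F {x, y} = ⊤) : IsSimpleRing T where
  simple := by
    refine { exists_pair_ne := ⟨⊥, ⊤, bot_ne_top⟩, eq_bot_or_eq_top := fun I => ?_ }
    rw [or_iff_not_imp_right]
    intro hI
    have h1 : (1 : T) ∉ I := fun h1 =>
      hI (eq_top_iff.2 fun y _ => by simpa using I.mul_mem_left y _ h1)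
    let J : Submodule F T :=
      { carrier := I
        add_mem' := I.add_mem
        zero_mem' := I.zero_mem
        smul_mem' := fun c t ht => by rw [Algebra.smul_def]; exact I.mul_mem_left _ _ ht }
    refine eq_bot_iff.2 fun t ht => ?_
    obtain ⟨c, rfl⟩ := h.exists_eq_sum htop t
    have := h.coeff_eq_zero_of_sum_mem' (J := J) (fun t ht => I.mul_mem_left _ _ ht)
      (fun t ht => I.mul_mem_right _ _ ht) (fun t ht => I.mul_mem_left _ _ ht)
      (fun t ht => I.mul_mem_right _ _ ht) h1 c ht
    simp [this]

theorem finiteDimensional (h : IsSymbolPair p x y a b) (htop : Algebra.adjoin F {x, y} = ⊤) :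
    FiniteDimensional F T := by
  have : Subalgebra.toSubmodule (⊤ : Subalgebra F T) = ⊤ := rfl
  rw [← htop, h.adjoin_eq_span] at this
  exact ⟨⟨(Set.finite_range _).toFinset, by simpa using this⟩⟩

theorem exists_eq_sum_aeval (h : IsSymbolPair p x y a b) (htop : Algebra.adjoin F {x, y} = ⊤)
    (t : T) : ∃ f : Fin p → F[X], (∀ k, (f k).natDegree < p) ∧
      t = ∑ m, aeval x (f m) * y ^ (m : ℕ) := by
  obtain ⟨c, rfl⟩ := h.exists_eq_sum htop t
  exact ⟨_, natDegree_sum_C_mul_X_pow_lt c, sum_smul_eq_sum_aeval c⟩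

theorem isCentral [CharP F p] [Nontrivial T] (h : IsSymbolPair p x y a b)
    (htop : Algebra.adjoin F {x, y} = ⊤) : Algebra.IsCentral F T where
  out z hz := by
    rw [Subalgebra.mem_center_iff] at hz
    obtain ⟨f, hf, rfl⟩ := h.exists_eq_sum_aeval htop z
    have hpos := hp.out.pos
    have h0 (m : Fin p) (hm : m ≠ ⟨0, hpos⟩) : f m = 0 := by
      have := h.coeff_eq_zero_of_sum_mem (J := ⊥) (by simp) (by simp) (by simp) (by simp) (by simp)
        (fun m => C ((m : ℕ) : F) * f m) (fun m => (natDegree_C_mul_le _ _).trans_lt (hf m))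
        (by
          rw [Submodule.mem_bot, ← sub_eq_zero.2 (hz x), Finset.mul_sum, Finset.sum_mul,
            ← Finset.sum_sub_distrib]
          refine Finset.sum_congr rfl fun m _ => ?_
          rw [h.commutator_aeval_mul_pow, map_mul, aeval_C, mul_assoc, Algebra.smul_def]) m
      refine (mul_eq_zero.1 this).resolve_left fun h0 => hm (Fin.ext ?_)
      rw [C_eq_zero, CharP.cast_eq_zero_iff F p] at h0
      exact Nat.eq_zero_of_dvd_of_lt h0 m.2
    rw [Finset.sum_eq_single ⟨0, hpos⟩ (fun m _ hm => by rw [h0 m hm]; simp) (by simp)] at hz ⊢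
    simp only [pow_zero, mul_one] at hz ⊢
    have hy := hz y
    rw [h.mul_aeval] at hy
    have hper : (f ⟨0, hpos⟩).comp (X - 1) - f ⟨0, hpos⟩ = 0 := by
      refine h.eq_zero_of_aeval_mem (J := ⊥) (by simp) (by simp) (by simp) _ _ rfl ?_ ?_
      · refine (natDegree_sub_le _ _).trans_lt (max_lt ?_ (hf _))
        rw [natDegree_comp, show (X - 1 : F[X]).natDegree = 1 from natDegree_X_sub_C 1, mul_one]
        exact hf _
      · refine h.mem_of_mul_pow_mem (k := 1) (by simp) hp.out.one_le ?_
        rw [pow_one, map_sub, sub_mul, hy, sub_self]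
        exact zero_mem _
    rw [eq_C_of_comp_sub_one (hf _) (sub_eq_zero.1 hper), aeval_C]
    exact Subalgebra.algebraMap_mem _ _

theorem isAzumaya [CharP F p] [Nontrivial T] (h : IsSymbolPair p x y a b)
    (htop : Algebra.adjoin F {x, y} = ⊤) : IsAzumaya F T :=
  have := h.isCentral htop
  have := h.isSimpleRing htop
  have := h.finiteDimensional htop
  isAzumaya_of_central_simple F T

end IsSymbolPair

end SymbolPair

namespace IsSymbolPair

section

variable {p : ℕ} {F T : Type*} [Field F] [Ring T] [Algebra F T] {x y : T} {a b : F}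

theorem map {T' : Type*} [Ring T'] [Algebra F T'] (h : IsSymbolPair p x y a b) (f : T →ₐ[F] T') :
    IsSymbolPair p (f x) (f y) a b where
  ne_zero := h.ne_zero
  pow_sub := by rw [← map_pow, ← map_sub, h.pow_sub, AlgHom.commutes]
  pow_eq := by rw [← map_pow, h.pow_eq, AlgHom.commutes]
  mul_eq := by rw [← map_mul, h.mul_eq, map_mul, map_sub, map_one]

theorem adjoin_val (S : Subalgebra F T) (hS : S = Algebra.adjoin F {x, y}) (hx : x ∈ S)
    (hy : y ∈ S) : Algebra.adjoin F {(⟨x, hx⟩ : S), ⟨y, hy⟩} = ⊤ := by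
  apply Subalgebra.map_injective (f := S.val) Subtype.val_injective
  rw [AlgHom.map_adjoin, Algebra.map_top, Subalgebra.range_val, Set.image_pair]
  exact hS.symm

theorem restrict (h : IsSymbolPair p x y a b) (S : Subalgebra F T) (hx : x ∈ S) (hy : y ∈ S) :
    IsSymbolPair p (⟨x, hx⟩ : S) ⟨y, hy⟩ a b where
  ne_zero := h.ne_zero
  pow_sub := Subtype.ext h.pow_sub
  pow_eq := Subtype.ext h.pow_eq
  mul_eq := Subtype.ext h.mul_eq

end

variable {p : ℕ} [hp : Fact p.Prime] {F D : Type*} [Field F] [CharP F p] [Ring D] [Algebra F D]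
  [Nontrivial D] {x y : D} {a b : F}

/-- A cyclic algebra is split by a `p`-th root of its second slot. -/
theorem exists_algHom_matrix (h : IsSymbolPair p x y a b) (htop : Algebra.adjoin F {x, y} = ⊤)
    (E : Type*) [Field E] [Algebra F E] (β : E) (hβ : β ^ p = algebraMap F E b) :
    Nonempty (D →ₐ[F] Matrix (Fin p) (Fin p) E) := by
  have hAz := h.isAzumaya htop
  have : CharP E p := charP_of_injective_algebraMap (algebraMap F E).injective p
  have hβ0 : β ≠ 0 := by
    rintro rfl
    rw [zero_pow hp.out.ne_zero] at hβ
    exact h.ne_zero ((map_eq_zero (algebraMap F E)).1 hβ.symm)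
  have hsimple : IsSimpleRing (E ⊗[F] D) := isSimpleRing_baseChange E
  let u : E ⊗[F] D := β⁻¹ ⊗ₜ y
  let i : E ⊗[F] D := 1 ⊗ₜ x
  have hmap (e : E) (c : F) : e ⊗ₜ[F] algebraMap F D c = (e * algebraMap F E c) ⊗ₜ[F] (1 : D) := by
    rw [Algebra.algebraMap_eq_smul_one, TensorProduct.tmul_smul, TensorProduct.smul_tmul',
      Algebra.smul_def, mul_comm]
  have hpair : IsSymbolPair p i u (algebraMap F E a) (1 : E) :=
    { ne_zero := one_ne_zero
      pow_sub := by
        simp only [i, Algebra.TensorProduct.tmul_pow, one_pow, ← TensorProduct.tmul_sub, h.pow_sub]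
        rw [hmap, one_mul, Algebra.TensorProduct.algebraMap_apply, Algebra.algebraMap_self_apply]
      pow_eq := by
        simp only [u, Algebra.TensorProduct.tmul_pow, h.pow_eq, inv_pow, hβ]
        rw [hmap, inv_mul_cancel₀ (by simpa using h.ne_zero), map_one,
          Algebra.TensorProduct.one_def]
      mul_eq := by
        simp only [i, u, Algebra.TensorProduct.one_def, ← TensorProduct.tmul_sub,
          Algebra.TensorProduct.tmul_mul_tmul, h.mul_eq, one_mul, mul_one] }
  have hgen : Algebra.adjoin E {i, u} = ⊤ := by
    have hD (d : D) : (1 : E) ⊗ₜ[F] d ∈ Algebra.adjoin E {i, u} := by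
      have hd : d ∈ Algebra.adjoin F {x, y} := by rw [htop]; trivial
      induction hd using Algebra.adjoin_induction with
      | mem z hz =>
        rcases hz with rfl | rfl
        · exact Algebra.subset_adjoin (by simp [i])
        · have : (1 : E) ⊗ₜ[F] z = β • u := by
            simp [u, TensorProduct.smul_tmul', mul_inv_cancel₀ hβ0]
          rw [this]
          exact Subalgebra.smul_mem _ (Algebra.subset_adjoin (by simp)) _
      | algebraMap c =>
        rw [Algebra.algebraMap_eq_smul_one, TensorProduct.tmul_smul, TensorProduct.smul_tmul']
        exact Subalgebra.algebraMap_mem _ (c • (1 : E))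
      | add s t _ _ hs ht => rw [TensorProduct.tmul_add]; exact add_mem hs ht
      | mul s t _ _ hs ht =>
        rw [← mul_one (1 : E), ← Algebra.TensorProduct.tmul_mul_tmul]; exact mul_mem hs ht
    refine eq_top_iff.2 fun r _ => ?_
    induction r with
    | zero => exact zero_mem _
    | add s t hs ht => exact add_mem (hs trivial) (ht trivial)
    | tmul e d =>
      have : e ⊗ₜ[F] d = e • ((1 : E) ⊗ₜ[F] d) := by simp [TensorProduct.smul_tmul']
      rw [this]
      exact Subalgebra.smul_mem _ (hD d) _
  let I : Ideal (E ⊗[F] D) := Ideal.span {u - 1}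
  let Q := (E ⊗[F] D) ⧸ I
  have hI : I ≠ ⊤ := by
    intro hI
    have hmem : (1 : E ⊗[F] D) ∈ I := by rw [hI]; trivial
    obtain ⟨r, hr⟩ := Ideal.mem_span_singleton'.1 hmem
    have hc (n : ℕ) : r ^ n * (u - 1) ^ n = 1 := by
      induction n with
      | zero => simp
      | succ n ih =>
        rw [pow_succ, pow_succ', mul_assoc, ← mul_assoc r, hr, one_mul, ih]
    have hnil : (u - 1) ^ p = 0 := by
      have : CharP (E ⊗[F] D) p := charP_of_injective_algebraMap (algebraMap E _).injective p
      rw [sub_pow_char_of_commute _ (Commute.one_right u), hpair.pow_eq, map_one, one_pow,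
        sub_self]
    have := hc p
    rw [hnil, mul_zero] at this
    exact zero_ne_one this
  have : Nontrivial Q := Submodule.Quotient.nontrivial_iff.2 hI
  let ρ : E ⊗[F] D →ₐ[E] Module.End E Q := Algebra.lsmul E E Q
  have hspan : Submodule.span E (Set.range fun k : Fin p =>
      (Submodule.Quotient.mk (i ^ (k : ℕ)) : Q)) = ⊤ := by
    refine eq_top_iff.2 fun q _ => ?_
    obtain ⟨r, rfl⟩ := Submodule.Quotient.mk_surjective I q
    obtain ⟨c, rfl⟩ := hpair.exists_eq_sum hgen r
    have hmk (n m : ℕ) : (Submodule.Quotient.mk (i ^ n * u ^ m) : Q) =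
        Submodule.Quotient.mk (i ^ n) := by
      induction m with
      | zero => simp
      | succ m ih =>
        rw [← ih, Submodule.Quotient.eq]
        have : i ^ n * u ^ (m + 1) - i ^ n * u ^ m = i ^ n * u ^ m * (u - 1) := by
          rw [pow_succ]; noncomm_ring
        rw [this]
        exact Ideal.mul_mem_left _ _ (Ideal.subset_span rfl)
    have : (Submodule.Quotient.mk (∑ k, c k • (i ^ (k.1 : ℕ) * u ^ (k.2 : ℕ))) : Q) =
        ∑ k, c k • (Submodule.Quotient.mk (i ^ (k.1 : ℕ)) : Q) := by
      refine Eq.trans ?_ (Finset.sum_congr rfl fun k _ => congrArg (c k • ·) (hmk k.1 k.2))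
      exact map_sum ((Submodule.mkQ I).restrictScalars E) _ _
    rw [this]
    exact sum_mem fun k _ => Submodule.smul_mem _ _ (Submodule.subset_span ⟨k.1, rfl⟩)
  have hfin : Module.Finite E Q := ⟨⟨(Set.finite_range _).toFinset, by simpa using hspan⟩⟩
  have hle : Module.finrank E Q ≤ p := by
    have := finrank_range_le_card (R := E) fun k : Fin p =>
      (Submodule.Quotient.mk (i ^ (k : ℕ)) : Q)
    rwa [Set.finrank, hspan, finrank_top, Fintype.card_fin] at this
  have hge : p ≤ Module.finrank E Q := by
    have hinj : Function.Injective ρ := RingHom.injective ρ.toRingHom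
    have h1 := LinearMap.finrank_le_finrank_of_injective (f := ρ.toLinearMap) hinj
    have h2 := hpair.finrank_adjoin
    rw [hgen, subalgebra_top_finrank_eq_submodule_top_finrank, finrank_top] at h2
    rw [h2, Module.finrank_linearMap, ← sq] at h1
    exact (Nat.pow_le_pow_iff_left two_ne_zero).1 h1
  let e := algEquivMatrix (Module.finBasisOfFinrankEq E Q (le_antisymm hle hge))
  exact ⟨((e.toAlgHom.comp ρ).restrictScalars F).comp Algebra.TensorProduct.includeRight⟩

end IsSymbolPair

section PiTensor

variable {F : Type*} [Field F] {m : ℕ}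

/-- Splitting off the first factor of a tensor product of algebras. -/
theorem nonempty_piTensor_finSucc (D : Fin (m + 1) → Type*) [∀ i, Ring (D i)]
    [∀ i, Algebra F (D i)] :
    Nonempty ((⨂[F] i, D i) ≃ₐ[F] D 0 ⊗[F] (⨂[F] i : Fin m, D i.succ)) := by
  classical
  let g : D 0 →ₗ[F] MultilinearMap F (fun i : Fin m => D i.succ)
      (D 0 ⊗[F] (⨂[F] i : Fin m, D i.succ)) :=
    { toFun := fun a => (TensorProduct.mk F _ _ a).compMultilinearMap (PiTensorProduct.tprod F)
      map_add' := fun a b => by ext; simp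
      map_smul' := fun c a => by ext; simp [TensorProduct.smul_tmul'] }
  let f : MultilinearMap F D (D 0 ⊗[F] (⨂[F] i : Fin m, D i.succ)) := g.uncurryLeft
  have hf (d : ∀ i, D i) : f d = d 0 ⊗ₜ PiTensorProduct.tprod F (fun i : Fin m => d i.succ) := rfl
  let Θ : (⨂[F] i, D i) →ₐ[F] D 0 ⊗[F] (⨂[F] i : Fin m, D i.succ) :=
    PiTensorProduct.liftAlgHom f rfl fun d d' => by
      simp only [hf, Algebra.TensorProduct.tmul_mul_tmul, PiTensorProduct.tprod_mul_tprod]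
      rfl
  let b (i) := Module.Free.chooseBasis F (D i)
  let B := Basis.piTensorProduct b
  let B' := (b 0).tensorProduct (Basis.piTensorProduct fun i : Fin m => b i.succ)
  have hΘ : Θ.toLinearMap = (B.equiv B' (Fin.consEquiv _).symm).toLinearMap := by
    refine B.ext fun k => ?_
    rw [LinearEquiv.coe_coe, B.equiv_apply]
    simp [B, B', Basis.piTensorProduct_apply, Θ, PiTensorProduct.liftAlgHom, hf, Fin.tail]
  refine ⟨AlgEquiv.ofBijective Θ ?_⟩
  have : (Θ : _ → _) = (B.equiv B' (Fin.consEquiv _).symm) := congr(⇑$hΘ)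
  rw [this]
  exact LinearEquiv.bijective _

end PiTensor

section Albert

/-- A commuting family `y` of `p`-th roots in an algebra, self-centralizing and of exponent one,
together with elements `x` acting on it as the logarithmic partial derivatives. -/
structure IsDiffSystem (p : ℕ) (F : Type*) {C : Type*} [Field F] [Ring C] [Algebra F C] {m : ℕ}
    (x y : Fin m → C) : Prop where
  comm : ∀ k l, y k * y l = y l * y k
  pow_eq : ∀ k, ∃ c : F, c ≠ 0 ∧ y k ^ p = algebraMap F C c
  commutator : ∀ k l, x k * y l - y l * x k = if k = l then y l else 0
  mem_adjoin : ∀ g, (∀ k, g * y k = y k * g) → g ∈ Algebra.adjoin F (Set.range y)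
  pow_mem : ∀ g, (∀ k, g * y k = y k * g) → ∃ c : F, g ^ p = algebraMap F C c

namespace IsDiffSystem

variable {p : ℕ} [hp : Fact p.Prime] {F : Type*} [Field F] [CharP F p] {C : Type*} [Ring C]
  [Algebra F C] [Nontrivial C] {m : ℕ}

theorem pow_commutator {x y : Fin m → C} (h : IsDiffSystem p F x y) (k l : Fin m) :
    x k ^ p * y l - y l * x k ^ p = if k = l then y l else 0 := by
  have : CharP C p := charP_of_injective_algebraMap (algebraMap F C).injective p
  have h1 := h.commutator k l
  split_ifs with hkl
  · rw [if_pos hkl, sub_eq_iff_eq_add] at h1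
    have h2 : SemiconjBy (y l) (x k + 1) (x k) := by
      rw [SemiconjBy, h1, mul_add, mul_one, add_comm]
    have h3 := (h2.pow_right p).eq
    rw [add_pow_char_of_commute _ (Commute.one_right _), one_pow, mul_add, mul_one] at h3
    rw [← h3, add_sub_cancel_left]
  · rw [if_neg hkl, sub_eq_zero] at h1
    rw [sub_eq_zero]
    exact (show Commute (x k) (y l) from h1).pow_left p

theorem isSymbolPair {x y : Fin m → C} (h : IsDiffSystem p F x y) (k : Fin m) :
    ∃ a b : F, IsSymbolPair p (x k ^ p) (y k) a b := by
  have : CharP C p := charP_of_injective_algebraMap (algebraMap F C).injective p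
  obtain ⟨b, hb0, hb⟩ := h.pow_eq k
  obtain ⟨a, ha⟩ := h.pow_mem (x k ^ p - x k) fun l => by
    have h1 := h.pow_commutator k l
    rw [← h.commutator k l] at h1
    rw [← sub_eq_zero] at h1 ⊢
    rw [← h1]
    noncomm_ring
  refine ⟨a, b, hb0, ?_, hb, ?_⟩
  · rw [← ha, sub_pow_char_of_commute _ ((Commute.refl _).pow_left p)]
  · have h1 := h.pow_commutator k k
    rw [if_pos rfl, sub_eq_iff_eq_add] at h1
    rw [sub_mul, h1, one_mul, add_sub_cancel_left]

end IsDiffSystem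

theorem IsDiffSystem.exists_decomposition {p : ℕ} (hp : p.Prime) {F : Type} [Field F]
    [CharP F p] (m : ℕ) : ∀ (C : Type) [Ring C] [Algebra F C] [Nontrivial C]
    (x y : Fin m → C), IsDiffSystem p F x y →
    ∃ D : Fin m → AlgCat.{0} F, (∀ i, IsCyclicPAlg p F (D i)) ∧
      Nonempty (C ≃ₐ[F] ⨂[F] i, (D i : Type)) := by
  have : Fact p.Prime := ⟨hp⟩
  induction m with
  | zero =>
    intro C _ _ _ x y h
    refine ⟨fun i => i.elim0, fun i => i.elim0, ?_⟩
    have hC : (⊥ : Subalgebra F C) = ⊤ := eq_top_iff.2 fun g _ => by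
      simpa using h.mem_adjoin g fun k => k.elim0
    have hbij : Function.Bijective (algebraMap F C) :=
      ⟨(algebraMap F C).injective, fun c => Algebra.mem_bot.1 (hC ▸ Algebra.mem_top)⟩
    have hbij' : Function.Bijective (algebraMap F (⨂[F] i : Fin 0, ((i.elim0 : AlgCat.{0} F) : Type))) := by
      have := (PiTensorProduct.isEmptyEquiv (R := F)
        (s := fun i : Fin 0 => ((i.elim0 : AlgCat.{0} F) : Type)) (Fin 0)).symm.bijective
      convert this using 1
      ext r
      rw [Algebra.algebraMap_eq_smul_one]
      change r • (1 : ⨂[F] i : Fin 0, ((i.elim0 : AlgCat.{0} F) : Type)) =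
        r • PiTensorProduct.tprod F isEmptyElim
      rw [PiTensorProduct.one_def]
      congr 2
      exact Subsingleton.elim _ _
    exact ⟨(AlgEquiv.ofBijective (Algebra.ofId F C) hbij).symm.trans
      (AlgEquiv.ofBijective (Algebra.ofId F _) hbij')⟩
  | succ m ih =>
    intro C _ _ _ x y h
    obtain ⟨a, b, hab⟩ := h.isSymbolPair 0
    let S := Algebra.adjoin F {x 0 ^ p, y 0}
    have hxS : x 0 ^ p ∈ S := Algebra.subset_adjoin (by simp)
    have hyS : y 0 ∈ S := Algebra.subset_adjoin (by simp)
    have hSpair := hab.restrict S hxS hyS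
    have hStop := IsSymbolPair.adjoin_val S rfl hxS hyS
    have : IsAzumaya F S := hSpair.isAzumaya hStop
    let C₁ := Subalgebra.centralizer F (S.val.range : Set C)
    obtain ⟨f, hf⟩ := Module.Projective.exists_dual_eq_one F (one_ne_zero (α := S))
    have hcomm (g : C) (hg : Commute g (x 0 ^ p)) (hg' : Commute g (y 0)) (s : S) :
        S.val s * g = g * S.val s := by
      obtain ⟨s, hs⟩ := s
      induction hs using Algebra.adjoin_induction with
      | mem z hz =>
        rcases hz with rfl | rfl
        · exact hg.symm
        · exact hg'.symm
      | algebraMap c => exact Algebra.commutes c g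
      | add s t _ _ hs ht => exact (Commute.add_left hs ht : Commute (_ + _) g)
      | mul s t _ _ hs ht => exact (Commute.mul_left hs ht : Commute (_ * _) g)
    have hmem₁ (g : C) (hg : ∀ s, S.val s * g = g * S.val s) : g ∈ C₁ := by
      refine (Subalgebra.mem_centralizer_iff F).2 ?_
      rintro _ ⟨s, rfl⟩
      exact hg s
    have hmem₂ (g : C) (hg : g ∈ C₁) (s : S) : S.val s * g = g * S.val s :=
      (Subalgebra.mem_centralizer_iff F).1 hg _ (S.val.mem_range_self s)
    have hy (l : Fin m) (s : S) : S.val s * y l.succ = y l.succ * S.val s := by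
      refine hcomm _ ?_ (h.comm _ _) s
      have := h.pow_commutator 0 l.succ
      rw [if_neg (Fin.succ_ne_zero l).symm, sub_eq_zero] at this
      exact this.symm
    let x' (l : Fin m) : C₁ := ⟨coeffProj S.val f (x l.succ), hmem₁ _ (coeffProj_comm S.val f _)⟩
    let y' (l : Fin m) : C₁ := ⟨y l.succ, hmem₁ _ (hy l)⟩
    have hall (g : C₁) (hg : ∀ k, g * y' k = y' k * g) (k : Fin (m + 1)) :
        (g : C) * y k = y k * g := by
      refine Fin.cases ?_ (fun l => ?_) k
      · exact (hmem₂ g g.2 ⟨y 0, hyS⟩).symm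
      · exact congrArg Subtype.val (hg l)
    have h' : IsDiffSystem p F x' y' :=
      { comm := fun k l => Subtype.ext (h.comm _ _)
        pow_eq := fun k => by
          obtain ⟨c, hc0, hc⟩ := h.pow_eq k.succ
          exact ⟨c, hc0, Subtype.ext hc⟩
        commutator := fun k l => Subtype.ext <| by
          have h1 : coeffProj S.val f (x k.succ) * y l.succ - y l.succ *
              coeffProj S.val f (x k.succ) =
              coeffProj S.val f (x k.succ * y l.succ - y l.succ * x k.succ) := by
            rw [map_sub, coeffProj_mul_right _ _ _ (hy l), coeffProj_mul_left _ _ _ (hy l)]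
          refine h1.trans ?_
          rw [h.commutator]
          by_cases hkl : k = l
          · have h2 := coeffProj_map_mul S.val f 1 (hy l)
            rw [map_one, one_mul, hf, one_smul] at h2
            rw [if_pos (by rw [hkl]), if_pos hkl, h2]
          · rw [if_neg fun h => hkl (Fin.succ_injective _ h), if_neg hkl, map_zero]
            rfl
        pow_mem := fun g hg => by
          obtain ⟨c, hc⟩ := h.pow_mem g (hall g hg)
          exact ⟨c, Subtype.ext hc⟩
        mem_adjoin := fun g hg => by
          let B := Algebra.adjoin F (Set.range fun l : Fin m => y l.succ)
          have key (z : C) (hz : z ∈ Algebra.adjoin F (Set.range y)) (t : C)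
              (ht : ∀ s, coeffProj S.val f (S.val s * t) ∈ B) (s : S) :
              coeffProj S.val f (S.val s * (z * t)) ∈ B := by
            induction hz using Algebra.adjoin_induction generalizing t s with
            | mem z hz =>
              obtain ⟨k, rfl⟩ := hz
              revert s
              refine Fin.cases ?_ (fun l => ?_) k
              · intro s
                have := ht (s * ⟨y 0, hyS⟩)
                rwa [map_mul S.val, mul_assoc] at this
              · intro s
                rw [← mul_assoc, hy, mul_assoc, coeffProj_mul_left _ _ _ (hy l)]
                exact mul_mem (Algebra.subset_adjoin ⟨l, rfl⟩) (ht s)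
            | algebraMap c =>
              rw [← Algebra.smul_def, mul_smul_comm, map_smul]
              exact Subalgebra.smul_mem _ (ht s) c
            | add z w _ _ hz hw =>
              rw [add_mul, mul_add, map_add]
              exact add_mem (hz t ht s) (hw t ht s)
            | mul z w _ _ hz hw =>
              rw [mul_assoc]
              exact hz _ (fun s => hw t ht s) s
          have h1 := key g (h.mem_adjoin g (hall g hg)) 1 (fun s => by
            rw [coeffProj_map_mul _ _ _ fun s => by simp]
            exact Subalgebra.smul_mem _ (one_mem _) _) 1
          rw [mul_one, coeffProj_map_mul _ _ _ (hmem₂ g g.2), hf, one_smul] at h1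
          have h2 : (Algebra.adjoin F (Set.range y')).map C₁.val = B := by
            rw [AlgHom.map_adjoin, ← Set.range_comp]
            rfl
          rw [← h2] at h1
          obtain ⟨g', hg', hgg⟩ := h1
          rwa [← Subtype.ext hgg] }
    obtain ⟨D, hD, ⟨e⟩⟩ := ih C₁ x' y' h'
    have hcons : ∀ i, IsCyclicPAlg p F ((Fin.cons (AlgCat.of F S) D : Fin (m + 1) → AlgCat F) i) :=
      Fin.cases (show IsCyclicPAlg p F S from ⟨a, b, hab.ne_zero, hab.finrank_adjoin, _, _,
        hSpair.pow_sub, hSpair.pow_eq, hSpair.mul_eq, hStop⟩) hD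
    refine ⟨_, hcons, ?_⟩
    · obtain ⟨e'⟩ := nonempty_piTensor_finSucc (F := F)
        (fun i => ((Fin.cons (AlgCat.of F S) D : Fin (m + 1) → AlgCat.{0} F) i : Type))
      let e₁ : C ≃ₐ[F] S ⊗[F] C₁ := (tensorCentralizerEquiv S.val).symm
      let e₂ : S ⊗[F] C₁ ≃ₐ[F] S ⊗[F] (⨂[F] i, (D i : Type)) :=
        Algebra.TensorProduct.congr AlgEquiv.refl e
      exact ⟨(e₁.trans e₂).trans e'.symm⟩

end Albert

section Derivations

open Polynomial in
/-- A simple purely inseparable extension of exponent one carries the derivation `y d/dy`. -/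
theorem exists_derivation_eq_self {K E : Type*} [Field K] [Field E] [Algebra K E] {p : ℕ}
    (hp : p.Prime) [CharP K p] {y : E} (hy : y ∉ (algebraMap K E).range) {c : K}
    (hc : y ^ p = algebraMap K E c) (htop : Algebra.adjoin K {y} = ⊤) :
    ∃ d : Derivation K E E, d y = y := by
  have : Fact p.Prime := ⟨hp⟩
  have : CharP E p := charP_of_injective_algebraMap (algebraMap K E).injective p
  have hirr : Irreducible (X ^ p - C c : K[X]) := by
    refine X_pow_sub_C_irreducible_of_prime hp fun z hz => hy ⟨z, ?_⟩
    refine frobenius_inj E p ?_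
    rw [frobenius_def, frobenius_def, hc, ← hz, map_pow]
  have hmin : X ^ p - C c = minpoly K y := by
    refine minpoly.eq_of_irreducible_of_monic hirr ?_ (monic_X_pow_sub_C c hp.ne_zero)
    simp [hc]
  have hsurj : Function.Surjective (aeval (R := K) y) := by
    rw [← AlgHom.range_eq_top, ← Algebra.adjoin_singleton_eq_range_aeval, htop]
  let δ : Derivation K K[X] K[X] := (X : K[X]) • derivative'
  have hδ (f : K[X]) (hf : aeval y f = 0) : aeval y (δ f) = 0 := by
    obtain ⟨g, rfl⟩ := hmin ▸ minpoly.dvd K y hf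
    simp [δ, hc, derivative_X_pow]
  refine ⟨Derivation.liftOfSurjective hsurj hδ, ?_⟩
  have h := Derivation.liftOfSurjective_apply hsurj hδ X
  simpa [δ] using h

/-- A minimal finite generating family of a field extension. -/
theorem exists_minimal_generators (F : Type*) {E : Type*} [Field F] [Field E] [Algebra F E]
    (S : Finset E) (hS : IntermediateField.adjoin F (S : Set E) = ⊤) :
    ∃ m ≤ S.card, ∃ y : Fin m → E, IntermediateField.adjoin F (Set.range y) = ⊤ ∧
      ∀ k, y k ∉ IntermediateField.adjoin F (y '' {k}ᶜ) := by
  classical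
  have hcard : ∃ y : Fin S.card → E, IntermediateField.adjoin F (Set.range y) = ⊤ := by
    refine ⟨fun i => S.equivFin.symm i, ?_⟩
    rw [← hS]
    congr 1
    ext z
    exact ⟨fun ⟨i, hi⟩ => hi ▸ (S.equivFin.symm i).2,
      fun hz => ⟨S.equivFin ⟨z, hz⟩, by simp⟩⟩
  have hex : ∃ m, ∃ y : Fin m → E, IntermediateField.adjoin F (Set.range y) = ⊤ := ⟨_, hcard⟩
  refine ⟨Nat.find hex, Nat.find_min' hex hcard, ?_⟩
  · obtain ⟨y, hy⟩ := Nat.find_spec hex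
    refine ⟨y, hy, fun k hk => ?_⟩
    obtain ⟨m, hm⟩ : ∃ m, Nat.find hex = m + 1 := Nat.exists_eq_succ_of_ne_zero (by have := k.2; omega)
    have hmin := Nat.find_min hex (m := m) (by omega)
    generalize Nat.find hex = N at *
    subst hm
    refine hmin ⟨y ∘ k.succAbove, ?_⟩
    rw [Set.range_comp, Fin.range_succAbove, eq_top_iff, ← hy, IntermediateField.adjoin_le_iff]
    rintro _ ⟨l, rfl⟩
    by_cases hl : l = k
    · exact hl ▸ hk
    · exact IntermediateField.subset_adjoin _ _ ⟨l, hl, rfl⟩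

/-- The logarithmic partial derivatives attached to a minimal generating family. -/
theorem exists_log_partials {F E : Type*} [Field F] [Field E] [Algebra F E] {p : ℕ}
    (hp : p.Prime) [CharP F p] (hpow : ∀ z : E, ∃ c : F, z ^ p = algebraMap F E c) {m : ℕ}
    (y : Fin m → E) (htop : IntermediateField.adjoin F (Set.range y) = ⊤)
    (hy : ∀ k, y k ∉ IntermediateField.adjoin F (y '' {k}ᶜ)) (k : Fin m) :
    ∃ d : Derivation F E E, ∀ l, d (y l) = if k = l then y l else 0 := by
  let K := IntermediateField.adjoin F (y '' {k}ᶜ)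
  have : CharP K p := charP_of_injective_algebraMap (algebraMap F K).injective p
  obtain ⟨c, hc⟩ := hpow (y k)
  have hyK : IntermediateField.adjoin K {y k} = ⊤ := by
    apply IntermediateField.restrictScalars_injective F
    rw [IntermediateField.restrictScalars_top, eq_top_iff, ← htop, IntermediateField.adjoin_le_iff]
    rintro _ ⟨l, rfl⟩
    by_cases hl : l = k
    · subst hl
      exact IntermediateField.mem_adjoin_simple_self K _
    · exact (IntermediateField.adjoin K {y k}).algebraMap_mem
        ⟨y l, IntermediateField.subset_adjoin _ _ ⟨l, hl, rfl⟩⟩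
  have hyint : IsAlgebraic K (y k) := by
    refine IsAlgebraic.of_pow hp.pos ?_
    rw [hc, IsScalarTower.algebraMap_apply F K E]
    exact isAlgebraic_algebraMap _
  obtain ⟨d, hd⟩ := exists_derivation_eq_self (K := K) (y := y k) (c := algebraMap F K c) hp
    (by rintro ⟨z, hz⟩; exact hy k (hz ▸ z.2)) hc
    (by rw [← IntermediateField.adjoin_simple_toSubalgebra_of_isAlgebraic hyint, hyK]; rfl)
  refine ⟨d.restrictScalars F, fun l => ?_⟩
  split_ifs with hl
  · subst hl; exact hd
  · exact d.map_algebraMap ⟨y l, IntermediateField.subset_adjoin _ _ ⟨l, Ne.symm hl, rfl⟩⟩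

end Derivations

section Representation

/-- The action of matrices over `E` on column vectors, over a subfield `F`. -/
noncomputable def mulVecEndHom (F : Type*) {E ι : Type*} [Field F] [Field E] [Algebra F E]
    [Fintype ι] [DecidableEq ι] : Matrix ι ι E →ₐ[F] Module.End F (ι → E) :=
  AlgHom.ofLinearMap
    { toFun := fun M => (Matrix.mulVecLin M).restrictScalars F
      map_add' := fun M N => LinearMap.ext fun v => Matrix.add_mulVec M N v
      map_smul' := fun c M => LinearMap.ext fun v => Matrix.smul_mulVec c M v }
    (LinearMap.ext fun v => Matrix.one_mulVec v)
    (fun M N => LinearMap.ext fun v => (Matrix.mulVec_mulVec v M N).symm)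

@[simp]
theorem mulVecEndHom_apply (F : Type*) {E ι : Type*} [Field F] [Field E] [Algebra F E]
    [Fintype ι] [DecidableEq ι] (M : Matrix ι ι E) (v : ι → E) :
    mulVecEndHom F M v = M.mulVec v := rfl

variable {F E B ι : Type*} [Field F] [Field E] [Algebra F E] [Ring B] [Algebra F B] [Fintype ι]
  [DecidableEq ι]

/-- The commutant of a matrix representation over `E`, acting `F`-linearly on column vectors. -/
abbrev commutant (φ : B →ₐ[F] Matrix ι ι E) : Subalgebra F (Module.End F (ι → E)) :=
  Subalgebra.centralizer F (((mulVecEndHom F).comp φ).range : Set (Module.End F (ι → E)))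

theorem mem_commutant {φ : B →ₐ[F] Matrix ι ι E} {g : Module.End F (ι → E)} :
    g ∈ commutant φ ↔ ∀ b v, (φ b).mulVec (g v) = g ((φ b).mulVec v) := by
  rw [Subalgebra.mem_centralizer_iff]
  constructor
  · intro h b v
    exact LinearMap.congr_fun (h _ ⟨b, rfl⟩) v
  · rintro h _ ⟨b, rfl⟩
    exact LinearMap.ext fun v => h b v

/-- The scalars of `E` inside the commutant. -/
noncomputable def commutantScalar (φ : B →ₐ[F] Matrix ι ι E) : E →ₐ[F] commutant φ :=
  (Algebra.lsmul F F (ι → E)).codRestrict _ fun e =>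
    mem_commutant.2 fun b v => Matrix.mulVec_smul (φ b) e v

theorem commutantScalar_apply (φ : B →ₐ[F] Matrix ι ι E) (e : E) (v : ι → E) :
    (commutantScalar φ e : Module.End F (ι → E)) v = e • v := rfl

variable [IsAzumaya F B]

theorem exists_eq_commutantScalar [Nonempty ι] (hdim : Fintype.card ι ^ 2 = Module.finrank F B)
    (φ : B →ₐ[F] Matrix ι ι E) (g : commutant φ)
    (hg : ∀ e : E, g * commutantScalar φ e = commutantScalar φ e * g) :
    ∃ e, g = commutantScalar φ e := by
  have hlin (e : E) (v : ι → E) : (g : Module.End F (ι → E)) (e • v) = e • (g.1 v) :=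
    LinearMap.congr_fun (congrArg Subtype.val (hg e)) v
  let g' : (ι → E) →ₗ[E] (ι → E) := { g.1 with map_smul' := hlin }
  have hcomm (M : Matrix ι ι E) : M * LinearMap.toMatrix' g' = LinearMap.toMatrix' g' * M := by
    obtain ⟨z, rfl⟩ := (baseChangeLift_bijective (E := E) hdim φ).2 M
    induction z using TensorProduct.induction_on with
    | zero => simp
    | add x y hx hy => rw [map_add, add_mul, mul_add, hx, hy]
    | tmul e b =>
      rw [baseChangeLift_tmul, smul_mul_assoc, mul_smul_comm]
      congr 1
      apply Matrix.toLin'.injective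
      rw [Matrix.toLin'_mul, Matrix.toLin'_mul, Matrix.toLin'_toMatrix']
      exact LinearMap.ext fun v => mem_commutant.1 g.2 b v
  obtain ⟨e, he⟩ := Matrix.mem_range_scalar_iff_commute_single'.2
    fun i j => hcomm (Matrix.single i j 1)
  refine ⟨e, Subtype.ext (LinearMap.ext fun v => ?_)⟩
  have h1 : g' v = (LinearMap.toMatrix' g').mulVec v := (LinearMap.toMatrix'_mulVec g' v).symm
  rw [← he] at h1
  rw [commutantScalar_apply]
  refine (show g.1 v = g' v from rfl).trans (h1.trans ?_)
  ext i
  simp [Matrix.scalar_apply, Matrix.mulVec_diagonal]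

theorem exists_commutant_derivation [Nontrivial B] (φ : B →ₐ[F] Matrix ι ι E) (d : Derivation F E E) :
    ∃ x : commutant φ, ∀ e, x * commutantScalar φ e - commutantScalar φ e * x =
      commutantScalar φ (d e) := by
  obtain ⟨m, hm⟩ := exists_inner_of_isAzumaya φ (-(d.toLinearMap.mapMatrix.comp φ.toLinearMap))
    (fun s t => by
      ext i j
      simp only [LinearMap.neg_apply, LinearMap.comp_apply, AlgHom.toLinearMap_apply, map_mul,
        Matrix.neg_apply, LinearMap.mapMatrix_apply, Matrix.map_apply, Matrix.mul_apply,
        Matrix.add_apply, map_sum, Derivation.coeFn_coe, Derivation.leibniz, smul_eq_mul,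
        mul_neg, neg_mul, Finset.sum_add_distrib, neg_add]
      congr 2
      exact Finset.sum_congr rfl fun k _ => mul_comm _ _)
  let δ : Module.End F (ι → E) := d.toLinearMap.compLeft ι
  have hδ (M : Matrix ι ι E) (v : ι → E) :
      δ (M.mulVec v) = M.mulVec (δ v) + (d.toLinearMap.mapMatrix M).mulVec v := by
    ext i
    simp [δ, Matrix.mulVec, dotProduct, Finset.sum_add_distrib, mul_comm]
  refine ⟨⟨δ - mulVecEndHom F m, mem_commutant.2 fun b v => ?_⟩, fun e => ?_⟩
  · rw [LinearMap.sub_apply, LinearMap.sub_apply, Matrix.mulVec_sub, hδ, mulVecEndHom_apply,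
      mulVecEndHom_apply, Matrix.mulVec_mulVec, Matrix.mulVec_mulVec]
    have h := congrArg (fun M => M.mulVec v) (hm b)
    simp only [Matrix.sub_mulVec, LinearMap.neg_apply, Matrix.neg_mulVec, LinearMap.comp_apply,
      AlgHom.toLinearMap_apply] at h
    rw [sub_eq_iff_eq_add] at h
    rw [h]
    abel
  · refine Subtype.ext (LinearMap.ext fun v => ?_)
    change (δ (e • v) - m.mulVec (e • v)) - e • (δ v - m.mulVec v) = d e • v
    have : δ (e • v) = e • δ v + d e • v := by
      ext i
      simp [δ, mul_comm]
    rw [this, Matrix.mulVec_smul, smul_sub]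
    abel

end Representation

section Splitting

theorem isDiffSystem_commutant {p : ℕ} (hp : p.Prime) {F E B ι : Type*} [Field F] [CharP F p]
    [Field E] [Algebra F E] [Ring B] [Algebra F B] [Fintype ι] [DecidableEq ι] [IsAzumaya F B]
    [Nontrivial B] [Nonempty ι] (hdim : Fintype.card ι ^ 2 = Module.finrank F B)
    (φ : B →ₐ[F] Matrix ι ι E) (hpow : ∀ z : E, ∃ c : F, z ^ p = algebraMap F E c) {m : ℕ}
    (y : Fin m → E) (htop : IntermediateField.adjoin F (Set.range y) = ⊤)
    (hy : ∀ k, y k ∉ IntermediateField.adjoin F (y '' {k}ᶜ)) :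
    ∃ x : Fin m → commutant φ, IsDiffSystem p F x fun k => commutantScalar φ (y k) := by
  choose d hd using exists_log_partials hp hpow y htop hy
  choose x hx using fun k => exists_commutant_derivation φ (d k)
  have hadj : Algebra.adjoin F (Set.range y) = ⊤ := by
    rw [← IntermediateField.adjoin_toSubalgebra_of_isAlgebraic, htop]
    · rfl
    · rintro _ ⟨k, rfl⟩
      obtain ⟨c, hc⟩ := hpow (y k)
      exact IsAlgebraic.of_pow hp.pos (hc ▸ isAlgebraic_algebraMap _)
  have hscalar (g : commutant φ)
      (hg : ∀ k, g * commutantScalar φ (y k) = commutantScalar φ (y k) * g) :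
      ∃ e, g = commutantScalar φ e := by
    refine exists_eq_commutantScalar hdim φ g fun e => ?_
    have he : e ∈ Algebra.adjoin F (Set.range y) := hadj ▸ Algebra.mem_top
    induction he using Algebra.adjoin_induction with
    | mem z hz =>
      obtain ⟨k, rfl⟩ := hz
      exact hg k
    | algebraMap c => rw [AlgHom.commutes, Algebra.commutes]
    | add s t _ _ hs ht => rw [map_add, mul_add, add_mul, hs, ht]
    | mul s t _ _ hs ht => rw [map_mul, ← mul_assoc, hs, mul_assoc, ht, mul_assoc]
  refine ⟨x, ⟨fun k l => ?_, fun k => ?_, fun k l => ?_, fun g hg => ?_, fun g hg => ?_⟩⟩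
  · rw [← map_mul, ← map_mul, mul_comm]
  · obtain ⟨c, hc⟩ := hpow (y k)
    refine ⟨c, fun h0 => hy k ?_, by rw [← map_pow, hc, AlgHom.commutes]⟩
    rw [h0, map_zero] at hc
    rw [eq_zero_of_pow_eq_zero hc]
    exact zero_mem _
  · rw [hx, hd]
    split_ifs <;> simp
  · obtain ⟨e, rfl⟩ := hscalar g hg
    have : (Algebra.adjoin F (Set.range y)).map (commutantScalar φ) =
        Algebra.adjoin F (Set.range fun k => commutantScalar φ (y k)) := by
      rw [AlgHom.map_adjoin, ← Set.range_comp]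
      rfl
    rw [← this, hadj]
    exact ⟨e, Algebra.mem_top, rfl⟩
  · obtain ⟨e, rfl⟩ := hscalar g hg
    obtain ⟨c, hc⟩ := hpow e
    exact ⟨c, by rw [← map_pow, hc, AlgHom.commutes]⟩

theorem isBrauerEquiv_of_op_tensor {F A C : Type} [Field F] [Ring A] [Algebra F A] [IsAzumaya F A]
    [Nontrivial A] [Ring C] [Algebra F C] {V : Type} [AddCommGroup V] [Module F V] [Module.Finite F V]
    [Nontrivial V] (e : Aᵐᵒᵖ ⊗[F] C ≃ₐ[F] Module.End F V) : IsBrauerEquiv F A C := by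
  let bA := Module.finBasis F A
  let bV := Module.finBasis F V
  refine ⟨_, _, Module.finrank_pos (R := F) (M := V), Module.finrank_pos (R := F) (M := A), ⟨?_⟩⟩
  let e₁ : A ⊗[F] Aᵐᵒᵖ ≃ₐ[F] Module.End F A :=
    AlgEquiv.ofBijective (AlgHom.mulLeftRight F A) IsAzumaya.bij
  refine (matrixEquivTensor (Fin _) F A).trans ?_
  refine (Algebra.TensorProduct.congr AlgEquiv.refl ((algEquivMatrix bV).symm.trans e.symm)).trans ?_
  refine (Algebra.TensorProduct.assoc F F F A Aᵐᵒᵖ C).symm.trans ?_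
  refine (Algebra.TensorProduct.congr (e₁.trans (algEquivMatrix bA)) AlgEquiv.refl).trans ?_
  refine (Algebra.TensorProduct.comm F _ C).trans ?_
  exact (matrixEquivTensor (Fin _) F C).symm

theorem exists_decomposition_of_splitting {p : ℕ} (hp : p.Prime) {F E A : Type} [Field F]
    [CharP F p] [Field E] [Algebra F E] [Ring A] [Algebra F A] (hA : IsCSA F A) {ι : Type}
    [Fintype ι] [DecidableEq ι] (hdim : Fintype.card ι ^ 2 = Module.finrank F A)
    (φ : A →ₐ[F] Matrix ι ι E) (hpow : ∀ z : E, ∃ c : F, z ^ p = algebraMap F E c)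
    (S : Finset E) (hS : IntermediateField.adjoin F (S : Set E) = ⊤) :
    SymbolLengthLE p F A S.card := by
  obtain ⟨_, _, _⟩ := hA
  have : Nonempty ι := by
    by_contra h
    rw [not_nonempty_iff] at h
    rw [Fintype.card_eq_zero] at hdim
    have := Module.finrank_pos (R := F) (M := A)
    omega
  have : Module.Finite F Aᵐᵒᵖ := Module.Finite.equiv (opLinearEquiv F)
  have : IsAzumaya F A := isAzumaya_of_central_simple F A
  have : IsAzumaya F Aᵐᵒᵖ := isAzumaya_of_central_simple F Aᵐᵒᵖ
  obtain ⟨m, hm, y, htop, hy⟩ := exists_minimal_generators F S hS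
  have : Module.Finite F E := by
    have h : FiniteDimensional F (IntermediateField.adjoin F (S : Set E)) :=
      IntermediateField.finiteDimensional_adjoin fun z _ => by
        obtain ⟨c, hc⟩ := hpow z
        exact IsIntegral.of_pow hp.pos (hc ▸ isIntegral_algebraMap)
    rw [hS] at h
    exact Module.Finite.equiv (IntermediateField.topEquiv (F := F) (E := E)).toLinearEquiv
  let φ' : Aᵐᵒᵖ →ₐ[F] Matrix ι ι E :=
    ((Matrix.transposeAlgEquiv ι F E).symm : _ →ₐ[F] _).comp φ.op
  have hdim' : Fintype.card ι ^ 2 = Module.finrank F Aᵐᵒᵖ :=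
    hdim.trans (opLinearEquiv F).finrank_eq
  obtain ⟨x, hx⟩ := isDiffSystem_commutant hp hdim' φ' hpow y htop hy
  obtain ⟨D, hD, ⟨e⟩⟩ := hx.exists_decomposition hp m (commutant φ')
  have hC : IsBrauerEquiv F A (commutant φ') :=
    isBrauerEquiv_of_op_tensor (tensorCentralizerEquiv ((mulVecEndHom F).comp φ'))
  obtain ⟨r, s, hr, hs, ⟨e'⟩⟩ := hC
  exact ⟨m, hm, fun i => D i, fun i => inferInstance, fun i => inferInstance, hD, r, s, hr, hs,
    ⟨e'.trans e.mapMatrix⟩⟩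

end Splitting

open scoped DirectSum

section Idempotents

/-- Endomorphisms of a finite direct sum of cyclic modules: the projections have commutative
corners. -/
theorem exists_projections_of_directSum_cyclic {R M ι : Type*} [CommRing R] [AddCommGroup M]
    [Module R M] [Fintype ι] (I : ι → Ideal R) (E : M ≃ₗ[R] ⨁ i, R ⧸ I i) :
    ∃ e : ι → Module.End R M, ∑ i, e i = 1 ∧
      ∀ i (f h : Module.End R M), e i * f * e i * h * e i = e i * h * e i * f * e i := by
  classical
  let e (i : ι) : Module.End R M :=
    E.symm.toLinearMap ∘ₗ DirectSum.lof R ι (fun i => R ⧸ I i) i ∘ₗ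
      DirectSum.component R ι (fun i => R ⧸ I i) i ∘ₗ E.toLinearMap
  refine ⟨e, ?_, fun i f h => ?_⟩
  · ext v
    apply E.injective
    simp only [e, LinearMap.sum_apply, LinearMap.comp_apply, map_sum, LinearEquiv.coe_coe,
      LinearEquiv.apply_symm_apply, Module.End.one_apply]
    ext i
    rw [DFinsupp.finsetSum_apply, Finset.sum_eq_single i]
    · exact DirectSum.lof_apply R i _
    · intro j _ hj
      exact DFinsupp.single_eq_of_ne (Ne.symm hj)
    · simp
  · have hcyc : ∃ w, ∀ v, ∃ c : R, e i v = c • w := by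
      refine ⟨E.symm (DirectSum.lof R ι (fun i => R ⧸ I i) i 1), fun v => ?_⟩
      obtain ⟨c, hc⟩ := Ideal.Quotient.mk_surjective (DirectSum.component R ι _ i (E v))
      refine ⟨c, ?_⟩
      rw [← map_smul, ← map_smul]
      simp only [e, LinearMap.comp_apply, LinearEquiv.coe_coe]
      rw [← hc, ← mul_one (Ideal.Quotient.mk (I i) c), ← Ideal.Quotient.algebraMap_eq,
        ← Algebra.smul_def]
    obtain ⟨w, hw⟩ := hcyc
    ext v
    obtain ⟨c, hc⟩ := hw v
    obtain ⟨a, ha⟩ := hw (f w)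
    obtain ⟨b, hb⟩ := hw (h w)
    simp only [Module.End.mul_apply, hc, map_smul, ha, hb]
    rw [smul_comm a b]

/-- The commutant of an endomorphism has a decomposition of `1` with commutative corners. -/
theorem exists_commuting_projections.{u, v} {F : Type u} {V : Type v} [Field F] [AddCommGroup V] [Module F V]
    [Module.Finite F V] (g : Module.End F V) :
    ∃ (ι : Type u) (_ : Fintype ι) (e : ι → Module.End F V), (∀ i, Commute g (e i)) ∧
      ∑ i, e i = 1 ∧ ∀ i (f h : Module.End F V), Commute g f → Commute g h →
        e i * f * e i * h * e i = e i * h * e i * f * e i := by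
  obtain ⟨ι, _, q, _, k, ⟨E⟩⟩ := Module.equiv_directSum_of_isTorsion
    (Module.AEval.isTorsion_of_finiteDimensional F V g)
  obtain ⟨e, he, hcomm⟩ := exists_projections_of_directSum_cyclic _ E
  let o := Module.AEval'.of g
  have ho (v : V) : o (g v) = (Polynomial.X : Polynomial F) • o v :=
    (Module.AEval'.X_smul_of g v).symm
  have ho' (v : Module.AEval' g) : o.symm ((Polynomial.X : Polynomial F) • v) = g (o.symm v) := by
    rw [LinearEquiv.symm_apply_eq, ho, LinearEquiv.apply_symm_apply]
  refine ⟨ι, inferInstance, fun i => o.symm.toLinearMap ∘ₗ (e i).restrictScalars F ∘ₗ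
    o.toLinearMap, fun i => ?_, ?_, fun i f h hf hh => ?_⟩
  · refine LinearMap.ext fun v => ?_
    simp [ho, ho']
  · refine LinearMap.ext fun v => o.injective ?_
    have := LinearMap.congr_fun he (o v)
    simpa using this
  · let lift (f : Module.End F V) (hf : Commute g f) : Module.End (Polynomial F) (Module.AEval' g) :=
      LinearMap.ofAEval g (o.toLinearMap ∘ₗ f) fun v => by
        have := LinearMap.congr_fun hf.eq v
        simp only [Module.End.mul_apply] at this
        simp [← ho, this]
    have hlift (f : Module.End F V) (hf : Commute g f) (v) : lift f hf v = o (f (o.symm v)) := rfl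
    refine LinearMap.ext fun v => o.injective ?_
    have := LinearMap.congr_fun (hcomm i (lift f hf) (lift h hh)) (o v)
    simpa [hlift] using this

end Idempotents

section Split

/-- A central simple algebra with an element spanning a commutative corner is split. -/
theorem nonempty_algEquiv_matrix_of_commutative_corner {K R : Type*} [Field K] [Ring R]
    [Algebra K R] [Algebra.IsCentral K R] [IsSimpleRing R] [Module.Finite K R] {e : R} (he : e ≠ 0)
    (hcomm : ∀ r s, e * r * e * s * e = e * s * e * r * e) :
    ∃ n, 0 < n ∧ Nonempty (R ≃ₐ[K] Matrix (Fin n) (Fin n) K) := by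
  have : IsArtinianRing R := IsArtinianRing.of_finite K R
  obtain ⟨n, _, D, _, _, _, ⟨E⟩⟩ := IsSimpleRing.exists_algEquiv_matrix_divisionRing_finite K R
  obtain ⟨i, j, hij⟩ : ∃ i j, E e i j ≠ 0 := by
    by_contra! h
    exact he (E.injective (by rw [map_zero]; ext i j; exact h i j))
  set c := E e i j
  have h1 (x y : D) : c * x * c * y * c = c * y * c * x * c := by
    have h := congrArg (fun r => E r i j)
      (hcomm (E.symm (Matrix.single j i x)) (E.symm (Matrix.single j i y)))
    simpa [Matrix.mul_apply, Matrix.single_apply, Finset.sum_ite_eq, ite_and, c] using h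
  have h2 (x y : D) : x * c * y = y * c * x := by
    have h := mul_right_cancel₀ hij (h1 x y)
    rw [mul_assoc c x c, mul_assoc c, mul_assoc c y c, mul_assoc c] at h
    exact mul_left_cancel₀ hij h
  have h3 (y : D) : c * y = y * c := by simpa using h2 1 y
  have h4 (x y : D) : x * y = y * x := by
    have h := h2 x y
    rw [← h3, ← h3, mul_assoc, mul_assoc] at h
    exact mul_left_cancel₀ hij h
  have hbij : Function.Bijective (algebraMap K D) := by
    refine ⟨(algebraMap K D).injective, fun d => ?_⟩
    have hd : E.symm (Matrix.scalar (Fin n) d) ∈ Subalgebra.center K R := by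
      rw [Subalgebra.mem_center_iff]
      intro r
      apply E.injective
      rw [map_mul, map_mul, AlgEquiv.apply_symm_apply]
      exact (Matrix.scalar_commute d (h4 d) (E r)).eq.symm
    rw [Algebra.IsCentral.center_eq_bot, Algebra.mem_bot] at hd
    obtain ⟨k, hk⟩ := hd
    refine ⟨k, ?_⟩
    have h := congrArg (fun r => E r 0 0) hk
    simpa [Matrix.algebraMap_matrix_apply] using h
  exact ⟨n, NeZero.pos n,
    ⟨E.trans (AlgEquiv.ofBijective (Algebra.ofId K D) hbij).symm.mapMatrix⟩⟩

end Split

section TateSum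

/-- In characteristic `p`, a sum over a set invariant under a map of order `p` is the sum over the
fixed points. -/
theorem sum_eq_sum_fixedPoints {p : ℕ} [hp : Fact p.Prime] {X M : Type*} [Fintype X]
    [DecidableEq X] [AddCommGroup M] (hM : ∀ m : M, p • m = 0) (τ : X → X) (hτ : τ^[p] = id)
    (h : X → M) (hh : ∀ x, h (τ x) = h x) :
    ∑ x, h x = ∑ x with τ x = x, h x := by
  classical
  have hmod (k l : ℕ) (m : M) (hkl : k ≡ l [MOD p]) : k • m = l • m := by
    rw [← Nat.mod_add_div k p, ← Nat.mod_add_div l p, add_smul, add_smul, mul_comm p, mul_comm p,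
      mul_smul, mul_smul, hM, smul_zero, smul_zero, hkl]
  rw [← Finset.sum_fiberwise_of_maps_to (t := Finset.univ.image h)
      (g := h) (fun x _ => Finset.mem_image_of_mem h (Finset.mem_univ x)),
    ← Finset.sum_fiberwise_of_maps_to (s := Finset.univ.filter fun x => τ x = x)
      (t := Finset.univ.image h) (g := h) (fun x _ => Finset.mem_image_of_mem h (Finset.mem_univ x))]
  refine Finset.sum_congr rfl fun m _ => ?_
  rw [Finset.sum_congr rfl (g := fun _ => m) (fun x hx => (Finset.mem_filter.1 hx).2),
    Finset.sum_congr rfl (g := fun _ => m)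
      (s₁ := (Finset.univ.filter fun x => τ x = x).filter fun x => h x = m)
      (fun x hx => (Finset.mem_filter.1 hx).2), Finset.sum_const, Finset.sum_const]
  refine hmod _ _ m ?_
  let τ' : Function.End {x // h x = m} := fun x => ⟨τ x, (hh x).trans x.2⟩
  have hit (k : ℕ) (x) : (((τ' ^ k : Function.End _) x : {x // h x = m}) : X) = τ^[k] x := by
    induction k with
    | zero => rfl
    | succ k ih =>
      rw [pow_succ', Function.iterate_succ_apply', ← ih]
      rfl
  have hone : τ' ^ p ^ 1 = 1 := by
    funext x
    apply Subtype.ext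
    rw [pow_one, hit, hτ]
    rfl
  have key := Equiv.Perm.card_fixedPoints_modEq hone
  rw [Fintype.card_subtype] at key
  convert key using 1
  rw [← Fintype.card_coe]
  refine Fintype.card_congr ⟨fun x => ⟨⟨x.1, ?_⟩, ?_⟩, fun x => ⟨x.1.1, ?_⟩, fun _ => rfl, fun _ => rfl⟩
  · have := x.2
    simp only [Finset.mem_filter, Finset.mem_univ, true_and] at this
    exact this.2
  · have := x.2
    simp only [Finset.mem_filter, Finset.mem_univ, true_and] at this
    exact Subtype.ext this.1
  · have := congrArg Subtype.val x.2
    simp only [Finset.mem_filter, Finset.mem_univ, true_and]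
    exact ⟨this, x.1.2⟩

end TateSum

section Frobenius

/-- The algebra endomorphism of a tensor power permuting the factors. -/
noncomputable def permTensorHom {p : ℕ} (F A : Type*) [Field F] [Ring A] [Algebra F A]
    (τ : Equiv.Perm (Fin p)) : (⨂[F] _ : Fin p, A) →ₐ[F] (⨂[F] _ : Fin p, A) :=
  PiTensorProduct.liftAlgHom ((PiTensorProduct.tprod F).domDomCongr τ)
    (by rw [MultilinearMap.domDomCongr_apply, PiTensorProduct.one_def]; rfl)
    (fun x y => by
      simp only [MultilinearMap.domDomCongr_apply, PiTensorProduct.tprod_mul_tprod]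
      rfl)

theorem permTensorHom_tprod {p : ℕ} {F A : Type*} [Field F] [Ring A] [Algebra F A]
    (τ : Equiv.Perm (Fin p)) (a : Fin p → A) :
    permTensorHom F A τ (PiTensorProduct.tprod F a) = PiTensorProduct.tprod F (a ∘ τ) :=
  PiTensorProduct.lift.tprod _

variable {p : ℕ} {F Φ A κ : Type*} [Field F] [Field Φ] [Algebra F Φ] [Ring A] [Algebra F A]
  (b : Module.Basis κ F A)

theorem piTensor_repr_permTensorHom (τ : Equiv.Perm (Fin p)) (u : ⨂[F] _ : Fin p, A)
    (f : Fin p → κ) :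
    (Basis.piTensorProduct fun _ : Fin p => b).repr (permTensorHom F A τ u) (f ∘ τ) =
      (Basis.piTensorProduct fun _ : Fin p => b).repr u f := by
  induction u using PiTensorProduct.induction_on with
  | smul_tprod r a =>
    simp only [map_smul, permTensorHom_tprod, Finsupp.smul_apply,
      Basis.piTensorProduct_repr_tprod_apply, Function.comp_apply]
    congr 1
    exact Equiv.prod_comp τ fun k => b.repr (a k) (f k)
  | add x y hx hy => simp only [map_add, Finsupp.add_apply, hx, hy]

variable [Fintype κ]

/-- The diagonal coefficients of a tensor of degree `p`, as an element of the Frobenius twist. -/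
noncomputable def diagCoeff (θ : F ≃+* Φ) : (⨂[F] _ : Fin p, A) →+ Φ ⊗[F] A where
  toFun u := ∑ i, θ ((Basis.piTensorProduct fun _ : Fin p => b).repr u fun _ => i) ⊗ₜ[F] b i
  map_zero' := by simp
  map_add' u v := by simp [TensorProduct.add_tmul, Finset.sum_add_distrib]

theorem diagCoeff_smul (θ : F ≃+* Φ) (c : F) (u : ⨂[F] _ : Fin p, A) :
    diagCoeff b θ (c • u) = θ c • diagCoeff b θ u := by
  simp [diagCoeff, Finset.smul_sum, TensorProduct.smul_tmul']

theorem diagCoeff_permTensorHom (θ : F ≃+* Φ) (τ : Equiv.Perm (Fin p)) (u : ⨂[F] _ : Fin p, A) :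
    diagCoeff b θ (permTensorHom F A τ u) = diagCoeff b θ u :=
  Finset.sum_congr rfl fun i _ => by
    rw [← piTensor_repr_permTensorHom b τ u fun _ => i]
    rfl

theorem diagCoeff_tprod_const {θ : F ≃+* Φ} (hθ : ∀ c, algebraMap F Φ c = θ c ^ p) (a : A) :
    diagCoeff b θ (PiTensorProduct.tprod F fun _ : Fin p => a) = 1 ⊗ₜ a := by
  conv_rhs => rw [← b.sum_repr a, TensorProduct.tmul_sum]
  refine Finset.sum_congr rfl fun i _ => ?_
  rw [Basis.piTensorProduct_repr_tprod_apply, Finset.prod_const, Finset.card_univ,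
    Fintype.card_fin, map_pow, ← hθ, TensorProduct.tmul_smul, TensorProduct.smul_tmul',
    Algebra.algebraMap_eq_smul_one]

theorem diagCoeff_one {θ : F ≃+* Φ} (hθ : ∀ c, algebraMap F Φ c = θ c ^ p) :
    diagCoeff (p := p) b θ 1 = 1 :=
  diagCoeff_tprod_const b hθ 1

open scoped Fin.CommRing in
theorem diagCoeff_mul [hp : Fact p.Prime] [CharP F p] {θ : F ≃+* Φ} (hθ : ∀ c, algebraMap F Φ c = θ c ^ p)
    {u v : ⨂[F] _ : Fin p, A} (hu : permTensorHom F A (Equiv.addRight 1) u = u)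
    (hv : permTensorHom F A (Equiv.addRight 1) v = v) :
    diagCoeff b θ (u * v) = diagCoeff b θ u * diagCoeff b θ v := by
  classical
  set τ : Equiv.Perm (Fin p) := Equiv.addRight 1
  set B := Basis.piTensorProduct fun _ : Fin p => b
  have hB (f : Fin p → κ) : B f = PiTensorProduct.tprod F (b ∘ f) :=
    Basis.piTensorProduct_apply _ _
  have hBτ (f : Fin p → κ) : permTensorHom F A τ (B f) = B (f ∘ τ) := by
    rw [hB, hB, permTensorHom_tprod]
    rfl
  have hΦ (m : Φ ⊗[F] A) : p • m = 0 := by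
    rw [← Nat.cast_smul_eq_nsmul F, CharP.cast_eq_zero, zero_smul]
  let h (x : (Fin p → κ) × (Fin p → κ)) : Φ ⊗[F] A :=
    (θ (B.repr u x.1) * θ (B.repr v x.2)) • diagCoeff b θ (B x.1 * B x.2)
  have hiter (k : ℕ) (x : (Fin p → κ) × (Fin p → κ)) :
      (fun x : (Fin p → κ) × (Fin p → κ) => (x.1 ∘ τ, x.2 ∘ τ))^[k] x =
        (fun l => x.1 (l + k • 1), fun l => x.2 (l + k • 1)) := by
    induction k with
    | zero => simp
    | succ k ih =>
      rw [Function.iterate_succ_apply', ih]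
      simp only [τ, succ_nsmul', Function.comp_def, Equiv.coe_addRight, add_assoc]
  have hsum : diagCoeff b θ (u * v) = ∑ x, h x := by
    conv_lhs => rw [← B.sum_repr u, ← B.sum_repr v, Finset.sum_mul_sum]
    rw [map_sum, Fintype.sum_prod_type]
    refine Finset.sum_congr rfl fun f _ => ?_
    rw [map_sum]
    refine Finset.sum_congr rfl fun g _ => ?_
    rw [smul_mul_smul_comm, diagCoeff_smul, map_mul]
  rw [hsum, sum_eq_sum_fixedPoints hΦ (fun x => (x.1 ∘ τ, x.2 ∘ τ)) ?_ h ?_]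
  · have hconst (f : Fin p → κ) (hf : f ∘ τ = f) (k : Fin p) : f 0 = f k := by
      have hn (n : ℕ) : f 0 = f n := by
        induction n with
        | zero => simp
        | succ n ih =>
          rw [ih, Nat.cast_succ]
          exact (congrFun hf n).symm
      rw [hn k, Fin.cast_val_eq_self]
    have hdiag : diagCoeff b θ u * diagCoeff b θ v =
        ∑ ij : κ × κ, h (fun _ => ij.1, fun _ => ij.2) := by
      rw [Fintype.sum_prod_type]
      refine (Finset.sum_mul_sum _ _ _ _).trans ?_
      refine Finset.sum_congr rfl fun i _ => Finset.sum_congr rfl fun j _ => ?_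
      simp only [h, hB, PiTensorProduct.tprod_mul_tprod]
      rw [Algebra.TensorProduct.tmul_mul_tmul]
      refine Eq.trans ?_ (congrArg _ (diagCoeff_tprod_const b hθ (b i * b j)).symm)
      rw [TensorProduct.smul_tmul', smul_eq_mul, mul_one]
    rw [hdiag]
    refine Finset.sum_nbij' (fun x => (x.1 0, x.2 0)) (fun ij => (fun _ => ij.1, fun _ => ij.2))
      (by simp) ?_ ?_ (by simp) ?_
    · intro ij _
      simp only [Finset.mem_filter, Finset.mem_univ, true_and]
      rfl
    · rintro ⟨f, g⟩ hx
      simp only [Finset.mem_filter, Finset.mem_univ, true_and, Prod.mk.injEq] at hx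
      exact Prod.ext (funext (hconst f hx.1)) (funext (hconst g hx.2))
    · rintro ⟨f, g⟩ hx
      simp only [Finset.mem_filter, Finset.mem_univ, true_and, Prod.mk.injEq] at hx
      exact congrArg h (Prod.ext (funext (hconst f hx.1)) (funext (hconst g hx.2))).symm
  · funext x
    rw [hiter]
    have : p • (1 : Fin p) = 0 := by
      rw [nsmul_one, Fin.natCast_self]
    simp [this]
  · intro x
    have h1 : B.repr u (x.1 ∘ τ) = B.repr u x.1 := by
      conv_lhs => rw [← hu]
      exact piTensor_repr_permTensorHom b τ u x.1
    have h2 : B.repr v (x.2 ∘ τ) = B.repr v x.2 := by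
      conv_lhs => rw [← hv]
      exact piTensor_repr_permTensorHom b τ v x.2
    simp only [h, h1, h2, ← hBτ, ← map_mul, diagCoeff_permTensorHom]

end Frobenius

section ExponentSplit

/-- In characteristic `p`, an algebra whose `p`-th tensor power is split is split by the extension
generated by all `p`-th roots. -/
theorem exists_algHom_matrix_of_split_power {p : ℕ} [hp : Fact p.Prime] {F Φ A : Type} [Field F]
    [CharP F p] [Field Φ] [Algebra F Φ] [Ring A] [Algebra F A] (hA : IsCSA F A)
    (hsplit : IsSplitAlg F (⨂[F] _ : Fin p, A)) (θ : F ≃+* Φ)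
    (hθ : ∀ c, algebraMap F Φ c = θ c ^ p) :
    ∃ n, n ^ 2 = Module.finrank F A ∧ Nonempty (A →ₐ[F] Matrix (Fin n) (Fin n) Φ) := by
  obtain ⟨_, _, _⟩ := hA
  obtain ⟨N, hN, ⟨ψ⟩⟩ := hsplit
  have : Nonempty (Fin N) := ⟨⟨0, hN⟩⟩
  have : IsAzumaya F A := isAzumaya_of_central_simple F A
  have : IsAzumaya F (Matrix (Fin N) (Fin N) F) := isAzumaya_of_central_simple F _
  have : Algebra.IsCentral Φ (Φ ⊗[F] A) := isCentral_baseChange Φ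
  have : IsSimpleRing (Φ ⊗[F] A) := isSimpleRing_baseChange Φ
  let b := Module.finBasis F A
  let σ := permTensorHom F A (Equiv.addRight (1 : Fin p))
  obtain ⟨g, hg⟩ := exists_conj_of_algHom_matrix (E := F) (ι := Fin N) (by simp [sq, Module.finrank_matrix])
    ((ψ : _ →ₐ[F] _).comp (σ.comp (ψ.symm : _ →ₐ[F] _))) (AlgHom.id F _)
  let ψ' : (⨂[F] _ : Fin p, A) ≃ₐ[F] Module.End F (Fin N → F) := ψ.trans Matrix.toLinAlgEquiv'
  have hfix (u : ⨂[F] _ : Fin p, A) 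
      (hu : Commute (Matrix.toLinAlgEquiv' (g : Matrix (Fin N) (Fin N) F)) (ψ' u)) :
      σ u = u := by
    have h1 : (g : Matrix (Fin N) (Fin N) F) * ψ u = ψ u * (g : Matrix (Fin N) (Fin N) F) := by
      apply Matrix.toLinAlgEquiv'.injective
      rw [map_mul, map_mul]
      exact hu
    have h2 := hg (ψ u)
    simp only [AlgHom.comp_apply, AlgEquiv.coe_toAlgHom, AlgEquiv.symm_apply_apply, AlgHom.id_apply] at h2
    rw [h1, Units.mul_inv_cancel_right] at h2
    exact ψ.injective h2
  have hfix' (u : ⨂[F] _ : Fin p, A) (hu : σ u = u) :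
      Commute (Matrix.toLinAlgEquiv' (g : Matrix (Fin N) (Fin N) F)) (ψ' u) := by
    have h2 := hg (ψ u)
    simp only [AlgHom.comp_apply, AlgEquiv.coe_toAlgHom, AlgEquiv.symm_apply_apply, AlgHom.id_apply, hu] at h2
    have h3 : (g : Matrix (Fin N) (Fin N) F) * ψ u = ψ u * (g : Matrix (Fin N) (Fin N) F) := by
      conv_rhs => rw [h2, Units.inv_mul_cancel_right]
    change _ * Matrix.toLinAlgEquiv' (ψ u) = Matrix.toLinAlgEquiv' (ψ u) * _
    rw [← map_mul, h3, map_mul]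
  obtain ⟨ι, _, e, heg, hsum, hcomm⟩ := exists_commuting_projections
    (Matrix.toLinAlgEquiv' (g : Matrix (Fin N) (Fin N) F))
  let ε (i : ι) := ψ'.symm (e i)
  have hε (i : ι) : σ (ε i) = ε i := hfix _ (by rw [AlgEquiv.apply_symm_apply]; exact heg i)
  have hεcomm (i : ι) (u v) (hu : σ u = u) (hv : σ v = v) :
      ε i * u * ε i * v * ε i = ε i * v * ε i * u * ε i := by
    apply ψ'.injective
    simp only [map_mul, ε, AlgEquiv.apply_symm_apply]
    exact hcomm i _ _ (hfix' u hu) (hfix' v hv)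
  have hmul (u v) (hu : σ u = u) (hv : σ v = v) :
      diagCoeff b θ (u * v) = diagCoeff b θ u * diagCoeff b θ v := diagCoeff_mul b hθ hu hv
  obtain ⟨i, hi⟩ : ∃ i, diagCoeff b θ (ε i) ≠ 0 := by
    by_contra! h
    have h1 : ∑ i, ε i = 1 := by rw [← map_sum, hsum, map_one]
    have h2 := congrArg (diagCoeff b θ) h1
    rw [map_sum, diagCoeff_one b hθ, Finset.sum_eq_zero fun i _ => h i] at h2
    exact zero_ne_one h2
  have hpure (x : Φ) (a : A) : ∃ u, σ u = u ∧ diagCoeff b θ u = x ⊗ₜ[F] a := by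
    refine ⟨θ.symm x • PiTensorProduct.tprod F fun _ => a, ?_, ?_⟩
    · rw [map_smul, permTensorHom_tprod]
      rfl
    · rw [diagCoeff_smul, diagCoeff_tprod_const b hθ, RingEquiv.apply_symm_apply,
        TensorProduct.smul_tmul', smul_eq_mul, mul_one]
  have hcorner (r s : Φ ⊗[F] A) : diagCoeff b θ (ε i) * r * diagCoeff b θ (ε i) * s *
      diagCoeff b θ (ε i) = diagCoeff b θ (ε i) * s * diagCoeff b θ (ε i) * r *
      diagCoeff b θ (ε i) := by
    induction r using TensorProduct.induction_on with
    | zero => simp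
    | add r₁ r₂ h₁ h₂ => simp only [mul_add, add_mul, h₁, h₂]
    | tmul x a =>
      induction s using TensorProduct.induction_on with
      | zero => simp
      | add r₁ r₂ h₁ h₂ => simp only [mul_add, add_mul, h₁, h₂]
      | tmul y c =>
        obtain ⟨u, hu, hu'⟩ := hpure x a
        obtain ⟨v, hv, hv'⟩ := hpure y c
        rw [← hu', ← hv']
        have h := congrArg (diagCoeff b θ) (hεcomm i u v hu hv)
        simpa only [hmul _ _ (show σ (ε i * u * ε i * v) = _ by simp only [map_mul, hε, hu, hv]) (hε i),
          hmul _ _ (show σ (ε i * u * ε i) = _ by simp only [map_mul, hε, hu]) hv,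
          hmul _ _ (show σ (ε i * u) = _ by simp only [map_mul, hε, hu]) (hε i),
          hmul _ _ (show σ (ε i * v * ε i * u) = _ by simp only [map_mul, hε, hu, hv]) (hε i),
          hmul _ _ (show σ (ε i * v * ε i) = _ by simp only [map_mul, hε, hv]) hu,
          hmul _ _ (show σ (ε i * v) = _ by simp only [map_mul, hε, hv]) (hε i),
          hmul _ _ (hε i) hu, hmul _ _ (hε i) hv] using h
  obtain ⟨n, hn, ⟨E⟩⟩ := nonempty_algEquiv_matrix_of_commutative_corner (K := Φ) hi hcorner
  refine ⟨n, ?_, ⟨(E.toAlgHom.restrictScalars F).comp Algebra.TensorProduct.includeRight⟩⟩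
  rw [← Module.finrank_baseChange (R := Φ), E.toLinearEquiv.finrank_eq]
  simp [sq, Module.finrank_matrix]

end ExponentSplit

section Frame

/-- The field of `p`-th roots of elements of an intermediate field. -/
def rootField (p : ℕ) [hp : Fact p.Prime] {F Ω : Type*} [Field F] [Field Ω] [Algebra F Ω]
    [CharP Ω p] (K : IntermediateField F Ω) : IntermediateField F Ω where
  carrier := {x | x ^ p ∈ K}
  mul_mem' {x y} hx hy := by
    rw [Set.mem_ofPred_eq, mul_pow]
    exact mul_mem hx hy
  add_mem' {x y} hx hy := by
    rw [Set.mem_ofPred_eq, add_pow_char]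
    exact add_mem hx hy
  algebraMap_mem' c := pow_mem (K.algebraMap_mem c) p
  inv_mem' x hx := by
    rw [Set.mem_ofPred_eq, inv_pow]
    exact inv_mem hx

theorem mem_rootField {p : ℕ} [hp : Fact p.Prime] {F Ω : Type*} [Field F] [Field Ω] [Algebra F Ω]
    [CharP Ω p] {K : IntermediateField F Ω} {x : Ω} : x ∈ rootField p K ↔ x ^ p ∈ K := Iff.rfl

/-- The sum of the first `p` conjugates under an endomorphism. -/
def cyclicTrace (p : ℕ) {F Ω : Type*} [Field F] [Field Ω] [Algebra F Ω] (σ : Ω →ₐ[F] Ω) (x : Ω) :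
    Ω :=
  ∑ k ∈ Finset.range p, (σ ^ k) x

/-- The product of the first `p` conjugates under an endomorphism. -/
def cyclicNorm (p : ℕ) {F Ω : Type*} [Field F] [Field Ω] [Algebra F Ω] (σ : Ω →ₐ[F] Ω) (x : Ω) :
    Ω :=
  ∏ k ∈ Finset.range p, (σ ^ k) x

/-- A cyclic Galois extension `L / F` of degree `p` inside a larger field `Ω`, with an endomorphism
of `Ω` inducing a generator of the Galois group and a basis `ω` of `L` over `F`. -/
structure IsCyclicFrame (p : ℕ) {F Ω : Type*} [Field F] [Field Ω] [Algebra F Ω]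
    (L : IntermediateField F Ω) (σ : Ω →ₐ[F] Ω) (ω : Fin p → Ω) : Prop where
  map_mem : ∀ x ∈ L, σ x ∈ L
  pow_apply : ∀ x ∈ L, (σ ^ p) x = x
  fixed : ∀ x ∈ L, σ x = x → ∃ c : F, x = algebraMap F Ω c
  gen_mem : ∀ j, ω j ∈ L
  span : ∀ x ∈ L, ∃ c : Fin p → F, x = ∑ j, algebraMap F Ω (c j) * ω j
  span_pow : ∀ x ∈ L, ∃ c : Fin p → F, x = ∑ j, algebraMap F Ω (c j) * ω j ^ p
  indep : ∀ f : ℕ → Ω, (∀ x ∈ L, ∑ k ∈ Finset.range p, f k * (σ ^ k) x = 0) → ∀ k < p, f k = 0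
  isAlgebraic : Algebra.IsAlgebraic F L

section Conjugates

variable {p : ℕ} {F Ω : Type*} [Field F] [Field Ω] [Algebra F Ω] {σ : Ω →ₐ[F] Ω} {x : Ω}

theorem map_cyclicTrace (hx : (σ ^ p) x = x) : σ (cyclicTrace p σ x) = cyclicTrace p σ x := by
  have h := Finset.sum_range_succ (fun k => (σ ^ k) x) p
  rw [Finset.sum_range_succ', hx, pow_zero, AlgHom.one_apply] at h
  rw [cyclicTrace, map_sum, ← add_right_cancel h]
  exact Finset.sum_congr rfl fun k _ => by rw [pow_succ', AlgHom.mul_apply]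

theorem map_cyclicNorm (hx : (σ ^ p) x = x) : σ (cyclicNorm p σ x) = cyclicNorm p σ x := by
  by_cases h0 : x = 0
  · rcases Nat.eq_zero_or_pos p with rfl | hp
    · simp [cyclicNorm]
    · rw [cyclicNorm, Finset.prod_eq_zero (Finset.mem_range.2 hp) (by simp [h0]), map_zero]
  have h := Finset.prod_range_succ (fun k => (σ ^ k) x) p
  rw [Finset.prod_range_succ', hx, pow_zero, AlgHom.one_apply] at h
  rw [cyclicNorm, map_prod, ← mul_right_cancel₀ h0 h]
  exact Finset.prod_congr rfl fun k _ => by rw [pow_succ', AlgHom.mul_apply]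

theorem pow_apply_eq_self (hx : σ x = x) (k : ℕ) : (σ ^ k) x = x := by
  induction k with
  | zero => rfl
  | succ k ih => rw [pow_succ, AlgHom.mul_apply, hx, ih]

end Conjugates

namespace IsCyclicFrame

theorem pow_mem {p : ℕ} {F Ω : Type*} [Field F] [Field Ω] [Algebra F Ω]
    {L : IntermediateField F Ω} {σ : Ω →ₐ[F] Ω} {ω : Fin p → Ω} (h : IsCyclicFrame p L σ ω)
    {x : Ω} (hx : x ∈ L) (k : ℕ) : (σ ^ k) x ∈ L := by
  induction k with
  | zero => exact hx
  | succ k ih => rw [pow_succ', AlgHom.mul_apply]; exact h.map_mem _ ih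

variable {p : ℕ} [hp : Fact p.Prime] {F Ω : Type*} [Field F] [Field Ω] [Algebra F Ω] [CharP Ω p]
  {L : IntermediateField F Ω} {σ : Ω →ₐ[F] Ω} {ω : Fin p → Ω}

theorem map_eq_self {x : Ω} (hx : x ∈ rootField p (⊥ : IntermediateField F Ω)) : σ x = x := by
  obtain ⟨c, hc⟩ := IntermediateField.mem_bot.1 (mem_rootField.1 hx)
  apply frobenius_inj Ω p
  rw [frobenius_def, frobenius_def, ← map_pow, ← hc, AlgHom.commutes]

theorem map_mem_rootField (h : IsCyclicFrame p L σ ω)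
    {x : Ω} (hx : x ∈ rootField p L) : σ x ∈ rootField p L := by
  rw [mem_rootField, ← map_pow]
  exact h.map_mem _ hx

theorem pow_apply_rootField (h : IsCyclicFrame p L σ ω)
    {x : Ω} (hx : x ∈ rootField p L) : (σ ^ p) x = x := by
  apply frobenius_inj Ω p
  rw [frobenius_def, frobenius_def, ← map_pow]
  exact h.pow_apply _ hx

theorem exists_coeff (h : IsCyclicFrame p L σ ω)
    (hperf : ∀ x : Ω, ∃ y, y ^ p = x) {y : Ω} (hy : y ∈ rootField p L) :
    ∃ c : Fin p → Ω, (∀ j, c j ∈ rootField p (⊥ : IntermediateField F Ω)) ∧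
      y = ∑ j, c j * ω j := by
  obtain ⟨c, hc⟩ := h.span_pow _ hy
  choose r hr using fun j => hperf (algebraMap F Ω (c j))
  refine ⟨r, fun j => ?_, frobenius_inj Ω p ?_⟩
  · rw [mem_rootField, hr]
    exact IntermediateField.algebraMap_mem _ _
  · rw [map_sum, frobenius_def, hc]
    exact Finset.sum_congr rfl fun j _ => by rw [frobenius_def, mul_pow, hr]

theorem exists_coeff_sup (h : IsCyclicFrame p L σ ω)
    {K : IntermediateField F Ω} {x : Ω} (hx : x ∈ L ⊔ K) :
    ∃ c : Fin p → Ω, (∀ j, c j ∈ K) ∧ x = ∑ j, c j * ω j := by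
  have := h.isAlgebraic
  have hx' : x ∈ Subalgebra.toSubmodule L.toSubalgebra * Subalgebra.toSubmodule K.toSubalgebra := by
    rw [Subalgebra.mul_toSubmodule, ← IntermediateField.sup_toSubalgebra_of_isAlgebraic_left]
    exact hx
  clear hx
  induction hx' using Submodule.mul_induction_on' with
  | mem_mul_mem l hl k hk =>
    obtain ⟨c, rfl⟩ := h.span l hl
    refine ⟨fun j => algebraMap F Ω (c j) * k, fun j => mul_mem (K.algebraMap_mem _) hk, ?_⟩
    rw [Finset.sum_mul]
    exact Finset.sum_congr rfl fun j _ => by ring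
  | add x _ y _ hx hy =>
    obtain ⟨c, hc, rfl⟩ := hx
    obtain ⟨d, hd, rfl⟩ := hy
    exact ⟨fun j => c j + d j, fun j => add_mem (hc j) (hd j), by
      simp only [add_mul, Finset.sum_add_distrib]⟩

theorem map_mem_sup (h : IsCyclicFrame p L σ ω)
    {K : IntermediateField F Ω} (hK : K ≤ rootField p ⊥) {x : Ω}
    (hx : x ∈ L ⊔ K) : σ x ∈ L ⊔ K := by
  obtain ⟨c, hc, rfl⟩ := h.exists_coeff_sup hx
  rw [map_sum]
  refine sum_mem fun j _ => ?_
  rw [map_mul, map_eq_self (hK (hc j))]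
  exact mul_mem (le_sup_right (a := L) (hc j)) (le_sup_left (a := L) (h.map_mem _ (h.gen_mem j)))

theorem exists_trace_eq_one (h : IsCyclicFrame p L σ ω) : ∃ x ∈ L, cyclicTrace p σ x = 1 := by
  obtain ⟨x, hx, hx0⟩ : ∃ x ∈ L, cyclicTrace p σ x ≠ 0 := by
    by_contra! h0
    refine one_ne_zero (h.indep (fun _ => 1) (fun x hx => ?_) 0 hp.out.pos)
    simpa [cyclicTrace] using h0 x hx
  have hfix := map_cyclicTrace (h.pow_apply x hx)
  obtain ⟨c, hc⟩ := h.fixed _ (sum_mem fun k _ => h.pow_mem hx k) hfix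
  have htr : cyclicTrace p σ x = algebraMap F Ω c := hc
  refine ⟨(cyclicTrace p σ x)⁻¹ * x, mul_mem (inv_mem (htr ▸ L.algebraMap_mem c)) hx, ?_⟩
  rw [← inv_mul_cancel₀ hx0]
  conv_lhs => rw [cyclicTrace]
  conv_rhs => arg 2; rw [cyclicTrace]
  rw [Finset.mul_sum]
  exact Finset.sum_congr rfl fun k _ => by
    rw [map_mul, map_inv₀, pow_apply_eq_self hfix]

theorem mem_of_map_eq_self (h : IsCyclicFrame p L σ ω)
    {K : IntermediateField F Ω} (hK : K ≤ rootField p ⊥) {x : Ω}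
    (hx : x ∈ L ⊔ K) (hfix : σ x = x) : x ∈ K := by
  obtain ⟨t, ht, ht1⟩ := h.exists_trace_eq_one
  obtain ⟨c, hc, hcx⟩ := h.exists_coeff_sup (mul_mem (le_sup_left (a := L) ht) hx)
  have h1 : x = cyclicTrace p σ (t * x) := by
    conv_lhs => rw [← one_mul x, ← ht1, cyclicTrace, Finset.sum_mul]
    exact Finset.sum_congr rfl fun k _ => by rw [map_mul, pow_apply_eq_self hfix]
  have h2 : cyclicTrace p σ (t * x) = ∑ j, c j * cyclicTrace p σ (ω j) := by
    simp only [cyclicTrace, hcx, map_sum, map_mul, Finset.mul_sum]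
    rw [Finset.sum_comm]
    exact Finset.sum_congr rfl fun j _ => Finset.sum_congr rfl fun k _ => by
      rw [pow_apply_eq_self (map_eq_self (hK (hc j)))]
  rw [h1, h2]
  refine sum_mem fun j _ => mul_mem (hc j) ?_
  obtain ⟨a, ha⟩ := h.fixed _ (sum_mem fun k _ => h.pow_mem (h.gen_mem j) k)
    (map_cyclicTrace (h.pow_apply _ (h.gen_mem j)))
  rw [show cyclicTrace p σ (ω j) = algebraMap F Ω a from ha]
  exact K.algebraMap_mem a

end IsCyclicFrame

end Frame

section NormStep

theorem Finset.prod_range_succ_shift {M : Type*} [CommMonoid M] (f : ℕ → M) {p : ℕ}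
    (hf : f p = f 0) : ∏ k ∈ Finset.range p, f (k + 1) = ∏ k ∈ Finset.range p, f k := by
  cases p with
  | zero => rfl
  | succ m => rw [Finset.prod_range_succ, Finset.prod_range_succ', hf]

open Polynomial in
/-- A simple root of a polynomial over `K` whose `p`-th power lies in `K` lies in `K`. -/
theorem IntermediateField.mem_of_pow_mem_of_simple_root {p : ℕ} [Fact p.Prime] {F Ω : Type*}
    [Field F] [Field Ω] [Algebra F Ω] [CharP Ω p] (K : IntermediateField F Ω) {t : Ω}
    (ht : t ^ p ∈ K) (Q : K[X]) (h0 : aeval t Q = 0) (h1 : aeval t (derivative Q) ≠ 0) :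
    t ∈ K := by
  have : CharP K p := (algebraMap K Ω).charP_iff (algebraMap K Ω).injective p |>.2 inferInstance
  have hyint : IsIntegral K t := by
    refine IsIntegral.of_pow (Fact.out : p.Prime).pos ?_
    exact isIntegral_algebraMap (R := K) (A := Ω) (x := ⟨t ^ p, ht⟩)
  obtain ⟨R, hR⟩ := minpoly.dvd K t h0
  have hsep : IsSeparable K t := by
    refine (separable_iff_derivative_ne_zero (minpoly.irreducible hyint)).2 fun hd => h1 ?_
    rw [hR, derivative_mul, hd, zero_mul, zero_add, map_mul, minpoly.aeval, zero_mul]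
  have hperf : t ∈ perfectClosure K Ω :=
    (mem_perfectClosure_iff_pow_mem p).2 ⟨1, ⟨t ^ p, ht⟩, by rw [pow_one]; rfl⟩
  have hbot : t ∈ separableClosure K Ω ⊓ perfectClosure K Ω :=
    ⟨mem_separableClosure_iff.2 hsep, hperf⟩
  rw [separableClosure_inf_perfectClosure, IntermediateField.mem_bot] at hbot
  obtain ⟨c, rfl⟩ := hbot
  exact c.2

namespace IsCyclicFrame

variable {p : ℕ} [hp : Fact p.Prime] {F Ω : Type*} [Field F] [Field Ω] [Algebra F Ω] [CharP Ω p]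
  {L : IntermediateField F Ω} {σ : Ω →ₐ[F] Ω} {ω : Fin p → Ω}

open Polynomial in
theorem exists_lift_polynomial (h : IsCyclicFrame p L σ ω) {K : IntermediateField F Ω}
    (hK : K ≤ rootField p ⊥) (P : Polynomial Ω)
    (hP : P ∈ lifts (algebraMap (L ⊔ K : IntermediateField F Ω) Ω))
    (hfix : P.map (σ : Ω →+* Ω) = P) :
    ∃ Q : K[X], Q.map (algebraMap K Ω) = P := by
  rw [← mem_lifts, lifts_iff_coeff_lifts]
  intro n
  obtain ⟨c, hc⟩ := (lifts_iff_coeff_lifts P).1 hP n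
  have hmem : P.coeff n ∈ L ⊔ K := hc ▸ c.2
  refine ⟨⟨P.coeff n, h.mem_of_map_eq_self hK hmem ?_⟩, rfl⟩
  conv_rhs => rw [← hfix, coeff_map]
  rfl

open Polynomial in
/-- If `u + w t` has norm in `K` with `u, w ∈ L K`, and `w / (u + w t)` has nonzero trace, then
`t ∈ K`. -/
theorem mem_of_norm_mem (h : IsCyclicFrame p L σ ω) {K : IntermediateField F Ω}
    (hK : K ≤ rootField p ⊥) {u w t : Ω} (hu : u ∈ L ⊔ K) (hw : w ∈ L ⊔ K)
    (hσu : (σ ^ p) u = u) (hσw : (σ ^ p) w = w)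
    (ht : t ∈ rootField p (⊥ : IntermediateField F Ω)) (hy : u + w * t ≠ 0)
    (hN : cyclicNorm p σ (u + w * t) ∈ K) (htr : cyclicTrace p σ (w / (u + w * t)) ≠ 0) :
    t ∈ K := by
  have hpow : ∀ {x : Ω} (_ : x ∈ L ⊔ K) (k : ℕ), (σ ^ k) x ∈ L ⊔ K := by
    intro x hx k
    induction k with
    | zero => exact hx
    | succ k ih => rw [pow_succ', AlgHom.mul_apply]; exact h.map_mem_sup hK ih
  let q : ℕ → Polynomial Ω := fun k => C ((σ ^ k) u) + C ((σ ^ k) w) * X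
  have hq : ∀ k, (q k).map (σ : Ω →+* Ω) = q (k + 1) := fun k => by
    simp only [q, Polynomial.map_add, Polynomial.map_mul, map_C, map_X, pow_succ' σ k,
      AlgHom.mul_apply]
    rfl
  have heval : ∀ k, (q k).eval t = (σ ^ k) (u + w * t) := fun k => by
    simp only [q, eval_add, eval_mul, eval_C, eval_X, map_add, map_mul,
      pow_apply_eq_self (map_eq_self ht)]
  obtain ⟨Q, hQ⟩ := h.exists_lift_polynomial hK (∏ k ∈ Finset.range p, q k)
    (prod_mem fun k _ => add_mem
      (C_mem_lifts (algebraMap (L ⊔ K : IntermediateField F Ω) Ω) ⟨_, hpow hu k⟩)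
      (mul_mem (C_mem_lifts (algebraMap (L ⊔ K : IntermediateField F Ω) Ω) ⟨_, hpow hw k⟩)
        (X_mem_lifts _)))
    (by
      rw [Polynomial.map_prod, Finset.prod_congr rfl fun k _ => hq k]
      refine Finset.prod_range_succ_shift _ ?_
      simp only [q, hσu, hσw, pow_zero, AlgHom.one_apply])
  refine K.mem_of_pow_mem_of_simple_root ((bot_le : ⊥ ≤ K) (mem_rootField.1 ht))
    (Q - C ⟨_, hN⟩) ?_ ?_
  · rw [map_sub, aeval_C, ← eval_map_algebraMap, hQ, eval_prod]
    simp only [heval]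
    exact sub_self _
  · rw [derivative_sub, derivative_C, sub_zero, ← eval_map_algebraMap, ← derivative_map, hQ,
      derivative_prod_finset, eval_finsetSum]
    have hN0 : cyclicNorm p σ (u + w * t) ≠ 0 :=
      Finset.prod_ne_zero_iff.2 fun k _ => by rwa [Ne, map_eq_zero]
    convert mul_ne_zero hN0 htr using 1
    rw [cyclicTrace, Finset.mul_sum]
    refine Finset.sum_congr rfl fun k hk => ?_
    rw [eval_mul, eval_prod, cyclicNorm, ← Finset.mul_prod_erase _ _ hk, map_div₀]
    have h0 : (σ ^ k) (u + w * t) ≠ 0 := by rwa [Ne, map_eq_zero]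
    simp only [heval]
    have hd : (derivative (q k)).eval t = (σ ^ k) w := by simp [q]
    rw [hd]
    field_simp

/-- An element of `L^{1/p}` whose norm lies in `K` is defined over `L` and an extension of `K`
generated by at most `p - 1` elements. -/
theorem exists_adjoin_of_norm_mem (h : IsCyclicFrame p L σ ω)
    (hperf : ∀ x : Ω, ∃ y, y ^ p = x) {K : IntermediateField F Ω}
    (hK : K ≤ rootField p ⊥) {y : Ω} (hy : y ∈ rootField p L) (hy0 : y ≠ 0)
    (hN : cyclicNorm p σ y ∈ K) :
    ∃ S : Finset Ω, S.card ≤ p - 1 ∧ (∀ s ∈ S, s ∈ rootField p (⊥ : IntermediateField F Ω)) ∧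
      y ∈ L ⊔ (K ⊔ IntermediateField.adjoin F (S : Set Ω)) := by
  classical
  obtain ⟨c, hc, hcy⟩ := h.exists_coeff hperf hy
  obtain ⟨j, hj⟩ : ∃ j, cyclicTrace p σ (ω j / y) ≠ 0 := by
    by_contra! h0
    refine inv_ne_zero hy0 (h.indep (fun k => (σ ^ k) y⁻¹) (fun x hx => ?_) 0 hp.out.pos)
    obtain ⟨a, rfl⟩ := h.span x hx
    have : ∀ k, (σ ^ k) y⁻¹ * (σ ^ k) (∑ j, algebraMap F Ω (a j) * ω j) =
        ∑ j, algebraMap F Ω (a j) * (σ ^ k) (ω j / y) := fun k => by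
      simp only [map_sum, map_mul, AlgHom.commutes, Finset.mul_sum, map_div₀, map_inv₀]
      exact Finset.sum_congr rfl fun j _ => by ring
    simp only [this]
    rw [Finset.sum_comm]
    refine Finset.sum_eq_zero fun j _ => ?_
    rw [← Finset.mul_sum]
    exact mul_eq_zero_of_right _ (h0 j)
  let S : Finset Ω := (Finset.univ.erase j).image c
  have hS : ∀ s ∈ S, s ∈ rootField p (⊥ : IntermediateField F Ω) := fun s hs => by
    obtain ⟨i, _, rfl⟩ := Finset.mem_image.1 hs
    exact hc i
  let K' := K ⊔ IntermediateField.adjoin F (S : Set Ω)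
  have hK' : K' ≤ rootField p ⊥ := sup_le hK (IntermediateField.adjoin_le_iff.2 hS)
  have hLmem : ∀ i, ω i ∈ L ⊔ K' := fun i => le_sup_left (a := L) (h.gen_mem i)
  have hLroot : L ≤ rootField p L := fun x hx => _root_.pow_mem hx p
  have hroot : rootField p (⊥ : IntermediateField F Ω) ≤ rootField p L := fun x hx =>
    (bot_le : ⊥ ≤ L) hx
  have hmem : ∀ i ≠ j, c i ∈ K' := fun i hi =>
    le_sup_right (a := K) (IntermediateField.subset_adjoin F _
      (Finset.mem_coe.2 (Finset.mem_image_of_mem c (Finset.mem_erase.2 ⟨hi, Finset.mem_univ i⟩))))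
  let u := ∑ i ∈ Finset.univ.erase j, c i * ω i
  have hyu : y = u + ω j * c j := by
    rw [hcy, ← Finset.sum_erase_add _ _ (Finset.mem_univ j), mul_comm (ω j)]
  have hu : u ∈ L ⊔ K' := sum_mem fun i hi =>
    mul_mem (le_sup_right (a := L) (hmem i (Finset.ne_of_mem_erase hi))) (hLmem i)
  have hu' : u ∈ rootField p L := sum_mem fun i _ => mul_mem (hroot (hc i)) (hLroot (h.gen_mem i))
  have hcj : c j ∈ K' := by
    refine h.mem_of_norm_mem hK' hu (hLmem j) (h.pow_apply_rootField hu')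
      (h.pow_apply _ (h.gen_mem j)) (hc j) ?_ ?_ ?_
    · rwa [← hyu]
    · rw [← hyu]; exact le_sup_left (a := K) hN
    · rwa [← hyu]
  refine ⟨S, ?_, hS, ?_⟩
  · refine Finset.card_image_le.trans ?_
    rw [Finset.card_erase_of_mem (Finset.mem_univ j), Finset.card_univ, Fintype.card_fin]
  · rw [hyu]
    exact add_mem hu (mul_mem (hLmem j) (le_sup_right (a := L) hcj))

end IsCyclicFrame

end NormStep

section MatrixOver

variable {F Ω : Type*} [Field F] [Field Ω] [Algebra F Ω] {A : Type*} [Ring A] [Algebra F A]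
  {ι : Type*} [Fintype ι] [DecidableEq ι]

/-- The restriction of a homomorphism into matrices whose entries lie in a subfield. -/
def restrictMatrix (K : IntermediateField F Ω) (φ : A →ₐ[F] Matrix ι ι Ω)
    (hφ : ∀ a, φ a ∈ K.toSubalgebra.matrix) : A →ₐ[F] Matrix ι ι K where
  toFun a := Matrix.of fun i j => ⟨φ a i j, hφ a i j⟩
  map_one' := by
    ext i j
    simp [Matrix.one_apply, apply_ite]
  map_mul' a b := by
    ext i j
    simp [Matrix.mul_apply]
  map_zero' := by
    ext i j
    simp
  map_add' a b := by
    ext i j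
    simp
  commutes' c := by
    ext i j
    simp only [AlgHom.commutes, Matrix.of_apply, Matrix.algebraMap_matrix_apply]
    split_ifs <;> rfl

theorem restrictMatrix_apply (K : IntermediateField F Ω) (φ : A →ₐ[F] Matrix ι ι Ω)
    (hφ : ∀ a, φ a ∈ K.toSubalgebra.matrix) (a : A) :
    K.val.mapMatrix (restrictMatrix K φ hφ a) = φ a := rfl

theorem mapMatrix_val_mem (K : IntermediateField F Ω) (M : Matrix ι ι K) :
    K.val.mapMatrix M ∈ K.toSubalgebra.matrix := fun i j => (M i j).2

/-- Two homomorphisms of an Azumaya algebra into matrices with entries in a subfield are conjugate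
over that subfield. -/
theorem exists_conj_mem_matrix [IsAzumaya F A] [Nonempty ι]
    (hdim : Fintype.card ι ^ 2 = Module.finrank F A) (K : IntermediateField F Ω)
    (φ ψ : A →ₐ[F] Matrix ι ι Ω) (hφ : ∀ a, φ a ∈ K.toSubalgebra.matrix)
    (hψ : ∀ a, ψ a ∈ K.toSubalgebra.matrix) :
    ∃ g g' : Matrix ι ι Ω, g ∈ K.toSubalgebra.matrix ∧ g' ∈ K.toSubalgebra.matrix ∧
      g * g' = 1 ∧ g' * g = 1 ∧ ∀ a, φ a = g * ψ a * g' := by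
  obtain ⟨g, hg⟩ := exists_conj_of_algHom_matrix hdim (restrictMatrix K φ hφ)
    (restrictMatrix K ψ hψ)
  refine ⟨K.val.mapMatrix g, K.val.mapMatrix (g⁻¹ : (Matrix ι ι K)ˣ), mapMatrix_val_mem K _,
    mapMatrix_val_mem K _, ?_, ?_, fun a => ?_⟩
  · rw [← map_mul, Units.mul_inv, map_one]
  · rw [← map_mul, Units.inv_mul, map_one]
  · rw [← restrictMatrix_apply K φ hφ, hg, map_mul, map_mul, restrictMatrix_apply]

theorem exists_eq_smul_one_of_commute [IsAzumaya F A] [Nonempty ι]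
    (hdim : Fintype.card ι ^ 2 = Module.finrank F A) (φ : A →ₐ[F] Matrix ι ι Ω)
    {M : Matrix ι ι Ω} (hM : ∀ a, M * φ a = φ a * M) : ∃ y : Ω, M = y • 1 := by
  have hcomm : ∀ x : Ω ⊗[F] A, M * baseChangeLift φ x = baseChangeLift φ x * M := by
    intro x
    induction x with
    | zero => rw [map_zero, mul_zero, zero_mul]
    | add x y hx hy => rw [map_add, mul_add, add_mul, hx, hy]
    | tmul e a => rw [baseChangeLift_tmul, mul_smul_comm, smul_mul_assoc, hM]
  have hc : M ∈ Subalgebra.center Ω (Matrix ι ι Ω) := Subalgebra.mem_center_iff.2 fun X => by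
    obtain ⟨x, rfl⟩ := (baseChangeLift_bijective hdim φ).2 X
    exact (hcomm x).symm
  obtain ⟨y, hy⟩ := Algebra.IsCentral.mem_center_iff Ω |>.1 hc
  exact ⟨y, by rw [hy, Algebra.algebraMap_eq_smul_one]⟩

theorem inv_mem_matrix (K : IntermediateField F Ω) {M : Matrix ι ι Ω}
    (hM : M ∈ K.toSubalgebra.matrix) (hu : IsUnit M.det) : M⁻¹ ∈ K.toSubalgebra.matrix := by
  let N : Matrix ι ι K := Matrix.of fun i j => ⟨M i j, hM i j⟩
  have hN : K.val.mapMatrix N = M := rfl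
  have hdet : IsUnit N.det := by
    rw [isUnit_iff_ne_zero] at hu ⊢
    intro h0
    refine hu ?_
    rw [← hN, ← AlgHom.map_det, h0, map_zero]
  rw [Matrix.inv_eq_right_inv (B := K.val.mapMatrix N⁻¹)
    (by rw [← hN, ← map_mul, Matrix.mul_nonsing_inv _ hdet, map_one])]
  exact mapMatrix_val_mem K _

theorem smul_mem_matrix (K : IntermediateField F Ω) {M : Matrix ι ι Ω}
    (hM : M ∈ K.toSubalgebra.matrix) {y : Ω} (hy : y ∈ K) : y • M ∈ K.toSubalgebra.matrix :=
  fun i j => K.mul_mem hy (hM i j)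

theorem mapMatrix_pow_apply (σ : Ω →ₐ[F] Ω) (k : ℕ) (M : Matrix ι ι Ω) (i j : ι) :
    ((σ.mapMatrix ^ k : Matrix ι ι Ω →ₐ[F] Matrix ι ι Ω) M) i j = (σ ^ k) (M i j) := by
  induction k with
  | zero => rfl
  | succ k ih =>
    rw [pow_succ', pow_succ', AlgHom.mul_apply, AlgHom.mul_apply, ← ih]
    rfl

end MatrixOver

section Descent

/-- A spanning set of column vectors contains the columns of an invertible matrix. -/
theorem exists_isUnit_det_of_span_eq_top {Ω ι : Type*} [Field Ω] [Fintype ι] [DecidableEq ι]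
    {t : Set (ι → Ω)} (ht : Submodule.span Ω t = ⊤) :
    ∃ T : Matrix ι ι Ω, IsUnit T.det ∧ ∀ l, T.col l ∈ t := by
  obtain ⟨b, hbt, hspan, hind⟩ := exists_linearIndependent Ω t
  let B : Module.Basis b Ω (ι → Ω) := Module.Basis.mk hind (by
    rw [Subtype.range_coe, hspan, ht])
  let e : ι ≃ b := (Pi.basisFun Ω ι).indexEquiv B
  refine ⟨Matrix.of fun i l => (e l : ι → Ω) i, ?_, fun l => hbt (e l).2⟩
  rw [← Matrix.isUnit_iff_isUnit_det, ← Matrix.linearIndependent_cols_iff_isUnit]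
  exact hind.comp e e.injective

namespace IsCyclicFrame

variable {p : ℕ} [hp : Fact p.Prime] {F Ω : Type*} [Field F] [Field Ω] [Algebra F Ω] [CharP Ω p]
  {L : IntermediateField F Ω} {σ : Ω →ₐ[F] Ω} {ω : Fin p → Ω}
  {ι : Type*} [Fintype ι] [DecidableEq ι]

theorem span_trace_eq_top (h : IsCyclicFrame p L σ ω) {g g' : Matrix ι ι Ω} (hg : g' * g = 1) :
    Submodule.span Ω {v : ι → Ω | ∃ x ∈ L, ∃ j, v = fun i => cyclicTrace p σ (g' i j * x)} = ⊤ := by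
  by_contra hne
  obtain ⟨f, hf0, hf⟩ := Submodule.exists_le_ker_of_lt_top _ (lt_top_iff_ne_top.2 hne)
  let c : ι → Ω := fun i => f (Pi.single i 1)
  have hfc : ∀ v : ι → Ω, f v = ∑ i, c i * v i := fun v => by
    conv_lhs => rw [← Finset.univ_sum_single v, map_sum]
    refine Finset.sum_congr rfl fun i _ => ?_
    rw [mul_comm, ← smul_eq_mul, ← map_smul, ← Pi.single_smul, smul_eq_mul, mul_one]
  have hz : Matrix.vecMul c g' = 0 := by
    funext j
    refine h.indep (fun k => ∑ i, c i * (σ ^ k) (g' i j)) (fun x hx => ?_) 0 hp.out.pos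
    have hv := hf (Submodule.subset_span ⟨x, hx, j, rfl⟩)
    rw [LinearMap.mem_ker, hfc] at hv
    rw [← hv]
    simp only [Finset.sum_mul, cyclicTrace, Finset.mul_sum, map_mul]
    rw [Finset.sum_comm]
    exact Finset.sum_congr rfl fun i _ => Finset.sum_congr rfl fun k _ => by ring
  have hc : c = 0 := by
    rw [← Matrix.vecMul_one c, ← hg, ← Matrix.vecMul_vecMul, hz, Matrix.zero_vecMul]
  refine hf0 (LinearMap.ext fun v => ?_)
  rw [hfc, hc]
  simp

/-- Hilbert 90 for the cocycle `g * σ(g)⁻¹`: it is trivialized by a matrix over `L K`. -/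
theorem exists_trivialization (h : IsCyclicFrame p L σ ω) {K : IntermediateField F Ω}
    (hK : K ≤ rootField p ⊥) {g g' : Matrix ι ι Ω} (hg : g' * g = 1) (hg' : g * g' = 1)
    (hmem : g' ∈ (rootField p L).toSubalgebra.matrix)
    (hW : g * σ.mapMatrix g' ∈ (L ⊔ K).toSubalgebra.matrix) :
    ∃ T : Matrix ι ι Ω, IsUnit T.det ∧ σ.mapMatrix T = T ∧
      g * T ∈ (L ⊔ K).toSubalgebra.matrix := by
  obtain ⟨T, hT, hcol⟩ := exists_isUnit_det_of_span_eq_top (h.span_trace_eq_top hg)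
  choose x hx j hj using hcol
  have hTe : ∀ i l, T i l = cyclicTrace p σ (g' i (j l) * x l) := fun i l => congrFun (hj l) i
  have hLroot : L ≤ rootField p L := fun z hz => _root_.pow_mem hz p
  let s : Matrix ι ι Ω →ₐ[F] Matrix ι ι Ω := σ.mapMatrix
  have hD : ∀ k : ℕ, g * (s ^ k) g' ∈ (L ⊔ K).toSubalgebra.matrix := by
    intro k
    induction k with
    | zero => rw [pow_zero, AlgHom.one_apply, hg']; exact one_mem _
    | succ k ih =>
      have : g * (s ^ (k + 1)) g' = (g * s g') * s (g * (s ^ k) g') := by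
        rw [map_mul, mul_assoc, ← mul_assoc (s g'), ← map_mul, hg, map_one, one_mul, pow_succ',
          AlgHom.mul_apply]
      rw [this]
      exact mul_mem hW fun i j => h.map_mem_sup hK (ih i j)
  let C : Matrix ι ι Ω := Matrix.of fun i l => if i = j l then x l else 0
  have hTC : T = ∑ k ∈ Finset.range p, (s ^ k) g' * (s ^ k) C := by
    ext i l
    rw [hTe, Matrix.sum_apply, cyclicTrace]
    refine Finset.sum_congr rfl fun k _ => ?_
    rw [← map_mul, mapMatrix_pow_apply, Matrix.mul_apply]
    simp [C]
  refine ⟨T, hT, ?_, ?_⟩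
  · ext i l
    refine (congrArg σ (hTe i l)).trans ?_
    rw [map_cyclicTrace, hTe]
    exact h.pow_apply_rootField (mul_mem (hmem i (j l)) (hLroot (hx l)))
  · rw [hTC, Finset.mul_sum]
    refine sum_mem fun k _ => ?_
    rw [← mul_assoc]
    refine mul_mem (hD k) fun i l => ?_
    rw [mapMatrix_pow_apply]
    refine le_sup_left (a := L) (h.pow_mem ?_ k)
    simp only [C, Matrix.of_apply]
    split_ifs
    · exact hx l
    · exact zero_mem _

variable {A : Type*} [Ring A] [Algebra F A] [IsAzumaya F A] [Nonempty ι]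

theorem exists_scalar_cocycle (h : IsCyclicFrame p L σ ω) {K : IntermediateField F Ω}
    (hK : K ≤ rootField p ⊥) (hdim : Fintype.card ι ^ 2 = Module.finrank F A)
    (φ₁ φ₂ : A →ₐ[F] Matrix ι ι Ω) (h₁ : ∀ a, φ₁ a ∈ (L ⊔ K).toSubalgebra.matrix)
    (h₂ : ∀ a, φ₂ a ∈ (rootField p (⊥ : IntermediateField F Ω)).toSubalgebra.matrix) :
    ∃ (g g' Z : Matrix ι ι Ω) (y : Ω), g' * g = 1 ∧ g * g' = 1 ∧
      g' ∈ (rootField p L).toSubalgebra.matrix ∧ Z ∈ (L ⊔ K).toSubalgebra.matrix ∧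
      y ∈ rootField p L ∧ y ≠ 0 ∧ cyclicNorm p σ y ∈ K ∧ Z = y • (g * σ.mapMatrix g') ∧
      ∀ a, φ₁ a = g * φ₂ a * g' := by
  have hLroot : L ≤ rootField p L := fun z hz => _root_.pow_mem hz p
  have hroot : rootField p (⊥ : IntermediateField F Ω) ≤ rootField p L := fun x hx =>
    (bot_le : ⊥ ≤ L) hx
  have hLK : L ⊔ K ≤ rootField p L := sup_le hLroot (hK.trans hroot)
  let s : Matrix ι ι Ω →ₐ[F] Matrix ι ι Ω := σ.mapMatrix
  have hs₂ : ∀ a, s (φ₂ a) = φ₂ a := fun a => by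
    ext i j
    exact map_eq_self (h₂ a i j)
  obtain ⟨g, g', hg, hg', hgg', hg'g, hconj⟩ := exists_conj_mem_matrix hdim (rootField p L) φ₁ φ₂
    (fun a i j => hLK (h₁ a i j)) (fun a i j => hroot (h₂ a i j))
  obtain ⟨Z, Z', hZ, hZ', hZZ', hZ'Z, hconjZ⟩ := exists_conj_mem_matrix hdim (L ⊔ K) φ₁
    (s.comp φ₁) h₁ fun a i j => h.map_mem_sup hK (h₁ a i j)
  have hsg : s g * s g' = 1 := by rw [← map_mul, hgg', map_one]
  have hsg' : s g' * s g = 1 := by rw [← map_mul, hg'g, map_one]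
  obtain ⟨y, hy⟩ := exists_eq_smul_one_of_commute hdim φ₂ (M := g' * Z * s g) fun a => by
    have e1 : φ₂ a = g' * φ₁ a * g := by
      rw [hconj]
      simp only [mul_assoc]
      rw [hg'g, mul_one, ← mul_assoc g', hg'g, one_mul]
    have e2 : s g * φ₂ a = s (φ₁ a) * s g := by
      rw [hconj, map_mul, map_mul, hs₂, mul_assoc, hsg', mul_one]
    have e3 : Z * s (φ₁ a) = φ₁ a * Z := by
      conv_rhs => rw [hconjZ]
      rw [mul_assoc _ Z', hZ'Z, mul_one]
      rfl
    have e4 : g' * φ₁ a = φ₂ a * g' := by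
      rw [e1, mul_assoc _ g, hgg', mul_one]
    rw [mul_assoc, e2, ← mul_assoc, mul_assoc g', e3, ← mul_assoc, e4]
    simp only [mul_assoc]
  have hZg : Z = y • (g * s g') := by
    have : g * (g' * Z * s g) * s g' = Z := by
      simp only [mul_assoc]
      rw [hsg, mul_one, ← mul_assoc, hgg', one_mul]
    rw [← this, hy, mul_smul_comm, mul_one, smul_mul_assoc]
  obtain ⟨i₀⟩ := ‹Nonempty ι›
  have hye : y = (g' * Z * s g) i₀ i₀ := by rw [hy]; simp
  have hyL : y ∈ rootField p L := by
    rw [hye]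
    have hM : g' * Z * s g ∈ (rootField p L).toSubalgebra.matrix :=
      mul_mem (mul_mem hg' fun i j => hLK (hZ i j)) fun i j => h.map_mem_rootField (hg i j)
    exact hM i₀ i₀
  have hy0 : y ≠ 0 := by
    rintro rfl
    rw [zero_smul] at hZg
    rw [hZg, zero_mul] at hZZ'
    exact zero_ne_one hZZ'
  have hprod : ∀ m : ℕ, (∏ k ∈ Finset.range m, (σ ^ k) y) • (g * (s ^ m) g') ∈
      (L ⊔ K).toSubalgebra.matrix := by
    intro m
    induction m with
    | zero =>
      rw [Finset.prod_range_zero, one_smul, pow_zero, AlgHom.one_apply, hgg']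
      exact one_mem _
    | succ m ih =>
      have : (∏ k ∈ Finset.range (m + 1), (σ ^ k) y) • (g * (s ^ (m + 1)) g') =
          Z * s ((∏ k ∈ Finset.range m, (σ ^ k) y) • (g * (s ^ m) g')) := by
        have hss : ∀ (c : Ω) (M : Matrix ι ι Ω), s (c • M) = σ c • s M := fun c M => by
          ext i j
          exact map_mul σ c (M i j)
        rw [hss, map_mul, hZg, smul_mul_smul_comm, mul_assoc, ← mul_assoc (s g'), hsg', one_mul,
          Finset.prod_range_succ', pow_zero, AlgHom.one_apply, mul_comm y, map_prod, pow_succ' s m,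
          AlgHom.mul_apply]
        congr 2
        exact Finset.prod_congr rfl fun k _ => by rw [pow_succ', AlgHom.mul_apply]
      rw [this]
      exact mul_mem hZ fun i j => h.map_mem_sup hK (ih i j)
  have hN : cyclicNorm p σ y ∈ L ⊔ K := by
    have hsp : (s ^ p) g' = g' := by
      ext i j
      rw [mapMatrix_pow_apply]
      exact h.pow_apply_rootField (hg' i j)
    have := hprod p i₀ i₀
    rw [hsp, hgg', Matrix.smul_apply, Matrix.one_apply_eq, smul_eq_mul, mul_one] at this
    exact this
  exact ⟨g, g', Z, y, hg'g, hgg', hg', hZ, hyL, hy0,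
    h.mem_of_map_eq_self hK hN (map_cyclicNorm (h.pow_apply_rootField hyL)), hZg, hconj⟩

/-- An algebra split by `L K` and by the field of `p`-th roots of elements of `F` is split by an
extension of `K` generated by at most `p - 1` elements. -/
theorem exists_descent (h : IsCyclicFrame p L σ ω) (hperf : ∀ x : Ω, ∃ y, y ^ p = x)
    {K : IntermediateField F Ω} (hK : K ≤ rootField p ⊥)
    (hdim : Fintype.card ι ^ 2 = Module.finrank F A)
    (φ₁ φ₂ : A →ₐ[F] Matrix ι ι Ω) (h₁ : ∀ a, φ₁ a ∈ (L ⊔ K).toSubalgebra.matrix)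
    (h₂ : ∀ a, φ₂ a ∈ (rootField p (⊥ : IntermediateField F Ω)).toSubalgebra.matrix) :
    ∃ S : Finset Ω, S.card ≤ p - 1 ∧ (∀ s ∈ S, s ∈ rootField p (⊥ : IntermediateField F Ω)) ∧
      ∃ ψ : A →ₐ[F] Matrix ι ι Ω,
        ∀ a, ψ a ∈ (K ⊔ IntermediateField.adjoin F (S : Set Ω)).toSubalgebra.matrix := by
  obtain ⟨g, g', Z, y, hg'g, hgg', hg', hZ, hyL, hy0, hN, hZg, hconj⟩ :=
    h.exists_scalar_cocycle hK hdim φ₁ φ₂ h₁ h₂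
  obtain ⟨S, hcard, hS, hyS⟩ := h.exists_adjoin_of_norm_mem hperf hK hyL hy0 hN
  refine ⟨S, hcard, hS, ?_⟩
  set K' := K ⊔ IntermediateField.adjoin F (S : Set Ω) with hK'def
  have hK' : K' ≤ rootField p ⊥ := sup_le hK (IntermediateField.adjoin_le_iff.2 hS)
  have hle : L ⊔ K ≤ L ⊔ K' := sup_le_sup_left le_sup_left L
  obtain ⟨T, hT, hσT, hgT⟩ := h.exists_trivialization hK' hg'g hgg' hg' (by
    rw [show g * σ.mapMatrix g' = y⁻¹ • Z by rw [hZg, smul_smul, inv_mul_cancel₀ hy0, one_smul]]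
    exact smul_mem_matrix _ (fun i j => hle (hZ i j)) (inv_mem hyS))
  have hTT : T * T⁻¹ = 1 := Matrix.mul_nonsing_inv T hT
  have hTT' : T⁻¹ * T = 1 := Matrix.nonsing_inv_mul T hT
  let ψ : A →ₐ[F] Matrix ι ι Ω :=
    { toFun := fun a => T⁻¹ * φ₂ a * T
      map_one' := by rw [map_one, mul_one, hTT']
      map_mul' := fun a b => by
        rw [map_mul]
        simp only [mul_assoc]
        rw [← mul_assoc T T⁻¹, hTT, one_mul]
      map_zero' := by rw [map_zero, mul_zero, zero_mul]
      map_add' := fun a b => by rw [map_add, mul_add, add_mul]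
      commutes' := fun c => by
        rw [AlgHom.commutes, ← Algebra.commutes, mul_assoc, hTT', mul_one] }
  have hψ : ∀ a, ψ a = T⁻¹ * φ₂ a * T := fun _ => rfl
  have hσT' : σ.mapMatrix T⁻¹ = T⁻¹ := by
    refine (Matrix.inv_eq_right_inv ?_).symm
    conv_lhs => rw [← hσT]
    rw [← map_mul, hσT, hTT, map_one]
  refine ⟨ψ, fun a i j => h.mem_of_map_eq_self hK' ?_ ?_⟩
  · have hgu : IsUnit (g * T).det := by
      rw [Matrix.det_mul]
      exact ((Matrix.isUnit_iff_isUnit_det g).1 ⟨⟨g, g', hgg', hg'g⟩, rfl⟩).mul hT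
    have hinv : (g * T)⁻¹ = T⁻¹ * g' := Matrix.inv_eq_right_inv (by
      rw [mul_assoc, ← mul_assoc T, hTT, one_mul, hgg'])
    have : ψ a = (g * T)⁻¹ * φ₁ a * (g * T) := by
      rw [hinv, hconj, hψ]
      simp only [mul_assoc]
      rw [← mul_assoc g' g, hg'g, one_mul, ← mul_assoc g' g, hg'g, one_mul]
    rw [this]
    exact mul_mem (mul_mem (inv_mem_matrix _ hgT hgu) fun i j => hle (h₁ a i j)) hgT i j
  · have : σ.mapMatrix (ψ a) = ψ a := by
      rw [hψ, map_mul, map_mul, hσT, hσT']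
      congr 2
      ext i j
      exact map_eq_self (h₂ a i j)
    exact congrFun (congrFun this i) j

end IsCyclicFrame

end Descent

section FrameExistence

theorem exists_isCyclicFrame {p : ℕ} [hp : Fact p.Prime] {F L Ω : Type*} [Field F] [CharP F p]
    [Field L] [Algebra F L] [IsGalois F L] [Field Ω] [Algebra F Ω] [Algebra L Ω]
    [IsScalarTower F L Ω] [IsAlgClosed Ω] [Algebra.IsAlgebraic L Ω]
    (hcyc : IsCyclic (L ≃ₐ[F] L)) (hLd : Module.finrank F L = p) :
    ∃ (σ : Ω →ₐ[F] Ω) (ω : Fin p → Ω),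
      IsCyclicFrame p (IsScalarTower.toAlgHom F L Ω).fieldRange σ ω := by
  have : FiniteDimensional F L := Module.finite_of_finrank_pos (by rw [hLd]; exact hp.out.pos)
  have : Algebra.IsAlgebraic F Ω := Algebra.IsAlgebraic.trans F L Ω
  have : IsAlgClosure F Ω := ⟨inferInstance, inferInstance⟩
  have : ExpChar F p := ExpChar.prime hp.out
  obtain ⟨τ, hτ⟩ := hcyc.exists_generator
  have hord : orderOf τ = p := by
    rw [orderOf_eq_card_of_forall_mem_zpowers hτ, IsGalois.card_aut_eq_finrank, hLd]
  let σ : Ω →ₐ[F] Ω := (τ.liftNormal Ω : Ω ≃ₐ[F] Ω)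
  have hσ : ∀ x, σ (algebraMap L Ω x) = algebraMap L Ω (τ x) := τ.liftNormal_commutes Ω
  have hσk : ∀ (k : ℕ) x, (σ ^ k) (algebraMap L Ω x) = algebraMap L Ω ((τ ^ k) x) := by
    intro k x
    induction k with
    | zero => rfl
    | succ k ih => rw [pow_succ', AlgHom.mul_apply, ih, hσ, pow_succ', AlgEquiv.mul_apply]
  let b := Module.finBasisOfFinrankEq F L hLd
  have hbp : LinearIndependent F fun j => b j ^ p := by
    simpa using b.linearIndependent.map_pow_expChar_pow_of_isSeparable' p 1
      fun i => Algebra.IsSeparable.isSeparable F (b i)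
  let b' := basisOfLinearIndependentOfCardEqFinrank hbp (by rw [hLd, Fintype.card_fin])
  refine ⟨σ, fun j => algebraMap L Ω (b j), ?_, ?_, ?_, ?_, ?_, ?_, ?_, ?_⟩
  · rintro _ ⟨x, rfl⟩
    exact ⟨τ x, (hσ x).symm⟩
  · rintro _ ⟨x, rfl⟩
    refine (hσk p x).trans ?_
    rw [← hord, pow_orderOf_eq_one]
    rfl
  · rintro _ ⟨x, rfl⟩ hx
    have hx' : τ x = x := (algebraMap L Ω).injective ((hσ x).symm.trans hx)
    have hbot : x ∈ (⊥ : IntermediateField F L) := by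
      rw [IsGalois.mem_bot_iff_fixed]
      intro f
      have hf : f ∈ MulAction.stabilizer (L ≃ₐ[F] L) x :=
        Subgroup.zpowers_le.2 (MulAction.mem_stabilizer_iff.2 hx') (hτ f)
      exact hf
    obtain ⟨c, rfl⟩ := IntermediateField.mem_bot.1 hbot
    exact ⟨c, (IsScalarTower.algebraMap_apply F L Ω c).symm⟩
  · exact fun j => ⟨b j, rfl⟩
  · rintro _ ⟨x, rfl⟩
    refine ⟨fun j => b.repr x j, ?_⟩
    refine (congrArg (algebraMap L Ω) (b.sum_repr x).symm).trans ?_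
    rw [map_sum]
    exact Finset.sum_congr rfl fun j _ => by
      rw [Algebra.smul_def, map_mul, ← IsScalarTower.algebraMap_apply]
  · rintro _ ⟨x, rfl⟩
    refine ⟨fun j => b'.repr x j, ?_⟩
    refine (congrArg (algebraMap L Ω) (b'.sum_repr x).symm).trans ?_
    rw [map_sum]
    exact Finset.sum_congr rfl fun j _ => by
      rw [Algebra.smul_def, map_mul, ← IsScalarTower.algebraMap_apply,
        coe_basisOfLinearIndependentOfCardEqFinrank, map_pow]
  · intro f hf k hk
    let m : Fin p → L →* Ω := fun i =>
      ((algebraMap L Ω : L →* Ω)).comp ((τ ^ (i : ℕ) : L ≃ₐ[F] L) : L →* L)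
    have hm : Function.Injective m := by
      intro i j hij
      apply Fin.ext
      refine pow_injOn_Iio_orderOf (x := τ) (by rw [hord]; exact i.2) (by rw [hord]; exact j.2) ?_
      refine AlgEquiv.ext fun x => (algebraMap L Ω).injective ?_
      exact DFunLike.congr_fun hij x
    have hli := (linearIndependent_monoidHom L Ω).comp m hm
    refine Fintype.linearIndependent_iff.1 hli (fun i => f i) ?_ ⟨k, hk⟩
    funext x
    have := hf (algebraMap L Ω x) ⟨x, rfl⟩
    rw [Finset.sum_range] at this
    simp only [hσk] at this
    rw [Finset.sum_apply]
    exact this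
  · exact (AlgEquiv.ofInjectiveField (IsScalarTower.toAlgHom F L Ω)).isAlgebraic

end FrameExistence

section Assembly

theorem finrank_piTensor {F κ : Type*} [Field F] [Fintype κ] (D : κ → Type*) [∀ i, Ring (D i)]
    [∀ i, Algebra F (D i)] [∀ i, FiniteDimensional F (D i)] :
    Module.finrank F (⨂[F] i, D i) = ∏ i, Module.finrank F (D i) := by
  classical
  rw [Module.finrank_eq_card_basis (Basis.piTensorProduct fun i => Module.finBasis F (D i)),
    Fintype.card_pi]
  exact Finset.prod_congr rfl fun i _ => Fintype.card_fin _

/-- Homomorphisms into matrix algebras combine to a homomorphism on the tensor product. -/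
theorem nonempty_piTensor_algHom_matrix {F E κ ν : Type*} [Field F] [Field E] [Algebra F E]
    [Fintype κ] [DecidableEq κ] [Fintype ν] [DecidableEq ν] (D : κ → Type*) [∀ i, Ring (D i)]
    [∀ i, Algebra F (D i)] (φ : ∀ i, D i →ₐ[F] Matrix ν ν E) :
    Nonempty ((⨂[F] i, D i) →ₐ[F] Matrix (κ → ν) (κ → ν) E) := by
  let entry (f g : κ → ν) : MultilinearMap F D E :=
    (MultilinearMap.mkPiAlgebra F κ E).compLinearMap fun i =>
      (Matrix.entryLinearMap F E (f i) (g i)).comp (φ i).toLinearMap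
  let m : MultilinearMap F D (Matrix (κ → ν) (κ → ν) E) :=
    MultilinearMap.pi fun f => MultilinearMap.pi fun g => entry f g
  have hm (d : ∀ i, D i) (f g : κ → ν) : m d f g = ∏ i, φ i (d i) (f i) (g i) := rfl
  refine ⟨PiTensorProduct.liftAlgHom m ?_ fun x y => ?_⟩
  · ext f g
    rw [hm]
    simp only [Pi.one_apply, map_one, Matrix.one_apply]
    rw [Finset.prod_ite_zero]
    simp [funext_iff]
  · ext f g
    rw [hm, Matrix.mul_apply]
    simp only [hm, Pi.mul_apply, map_mul, Matrix.mul_apply, ← Finset.prod_mul_distrib]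
    rw [Finset.prod_univ_sum, Fintype.piFinset_univ]

theorem IsCyclicAlgWith.exists_algHom_matrix {p : ℕ} [hp : Fact p.Prime] {F D : Type} [Field F]
    [CharP F p] [Ring D] [Algebra F D] {a b : F} (h : IsCyclicAlgWith p F D a b) {E : Type*}
    [Field E] [Algebra F E] (β : E) (hβ : β ^ p = algebraMap F E b) :
    Nonempty (D →ₐ[F] Matrix (Fin p) (Fin p) E) := by
  obtain ⟨hb, hdim, x, y, hx, hy, hxy, htop⟩ := h
  have : Nontrivial D := Module.nontrivial_of_finrank_pos (R := F)
    (by rw [hdim]; exact pow_pos hp.out.pos 2)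
  exact IsSymbolPair.exists_algHom_matrix ⟨hb, hx, hy, hxy⟩ htop E β hβ

/-- The inverse Frobenius from `F` to the field of `p`-th roots of its elements. -/
theorem exists_ringEquiv_rootField_bot {p : ℕ} [hp : Fact p.Prime] {F Ω : Type*} [Field F]
    [Field Ω] [Algebra F Ω] [CharP Ω p] (hperf : ∀ x : Ω, ∃ y, y ^ p = x) :
    ∃ θ : F ≃+* rootField p (⊥ : IntermediateField F Ω),
      ∀ c, algebraMap F (rootField p (⊥ : IntermediateField F Ω)) c = θ c ^ p := by
  let f : rootField p (⊥ : IntermediateField F Ω) →+* (⊥ : IntermediateField F Ω) :=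
    ((frobenius Ω p).comp (algebraMap (rootField p (⊥ : IntermediateField F Ω)) Ω)).codRestrict
      (⊥ : IntermediateField F Ω).toSubfield fun x => x.2
  have hf : ∀ x, (f x : Ω) = (x : Ω) ^ p := fun _ => rfl
  have hbij : Function.Bijective f := by
    refine ⟨f.injective, fun y => ?_⟩
    obtain ⟨x, hx⟩ := hperf y
    exact ⟨⟨x, by rw [mem_rootField, hx]; exact y.2⟩, Subtype.ext hx⟩
  let e := RingEquiv.ofBijective f hbij
  refine ⟨(IntermediateField.botEquiv F Ω).symm.toRingEquiv.trans e.symm, fun c => ?_⟩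
  apply Subtype.ext
  have h1 := hf (e.symm ((IntermediateField.botEquiv F Ω).symm c))
  rw [show f (e.symm ((IntermediateField.botEquiv F Ω).symm c)) =
    (IntermediateField.botEquiv F Ω).symm c from e.apply_symm_apply _,
    IntermediateField.botEquiv_symm] at h1
  exact h1

theorem SymbolLengthLE.mono {p : ℕ} {F A : Type} [Field F] [Ring A] [Algebra F A] {m m' : ℕ}
    (h : SymbolLengthLE p F A m) (hm : m ≤ m') : SymbolLengthLE p F A m' := by
  obtain ⟨k, hk, h⟩ := h
  exact ⟨k, hk.trans hm, h⟩

theorem SymbolLengthLE.of_matrix {p : ℕ} {F A : Type} [Field F] [Ring A] [Algebra F A] {r m : ℕ}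
    (hr : 0 < r) (h : SymbolLengthLE p F (Matrix (Fin r) (Fin r) A) m) :
    SymbolLengthLE p F A m := by
  obtain ⟨k, hk, D, i1, i2, hD, s, t, hs, ht, ⟨e⟩⟩ := h
  exact ⟨k, hk, D, i1, i2, hD, s * r, t, Nat.mul_pos hs hr, ht,
    ⟨((Matrix.reindexAlgEquiv F A finProdFinEquiv).symm.trans
      (Matrix.compAlgEquiv _ _ _ _).symm).trans e⟩⟩

theorem IsCSA.matrix {F A : Type} [Field F] [Ring A] [Algebra F A] (hA : IsCSA F A) {r : ℕ}
    (hr : 0 < r) : IsCSA F (Matrix (Fin r) (Fin r) A) := by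
  obtain ⟨_, _, _⟩ := hA
  have : Nonempty (Fin r) := ⟨⟨0, hr⟩⟩
  exact ⟨inferInstance, inferInstance, inferInstance⟩

/-- An algebra split by matrices over a field generated by finitely many `p`-th roots. -/
theorem symbolLengthLE_of_mem_matrix {p : ℕ} [hp : Fact p.Prime] {F Ω A : Type} [Field F]
    [CharP F p] [Field Ω] [Algebra F Ω] [CharP Ω p] [Ring A] [Algebra F A] (hA : IsCSA F A)
    {ι : Type} [Fintype ι] [DecidableEq ι] (hdim : Fintype.card ι ^ 2 = Module.finrank F A)
    (S : Finset Ω) (hS : ∀ s ∈ S, s ∈ rootField p (⊥ : IntermediateField F Ω))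
    (ψ : A →ₐ[F] Matrix ι ι Ω)
    (hψ : ∀ a, ψ a ∈ (IntermediateField.adjoin F (S : Set Ω)).toSubalgebra.matrix) :
    SymbolLengthLE p F A S.card := by
  classical
  set E := IntermediateField.adjoin F (S : Set Ω) with hE
  have hSE : ∀ s ∈ S, s ∈ E := fun s hs => IntermediateField.subset_adjoin F _ hs
  have hle : E ≤ rootField p ⊥ := IntermediateField.adjoin_le_iff.2 hS
  let S' : Finset E := S.attach.image fun s : {x // x ∈ S} => ⟨s, hSE s s.2⟩
  refine (exists_decomposition_of_splitting hp.out hA hdim (restrictMatrix E ψ hψ) (fun z => ?_) S'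
    ?_).mono ((Finset.card_image_le).trans_eq S.card_attach)
  · obtain ⟨c, hc⟩ := IntermediateField.mem_bot.1 (mem_rootField.1 (hle z.2))
    exact ⟨c, Subtype.ext hc.symm⟩
  · apply IntermediateField.lift_injective E
    rw [IntermediateField.lift_top, IntermediateField.lift_adjoin]
    conv_rhs => rw [hE]
    congr 1
    ext x
    simp only [S', Finset.coe_image, Set.mem_image, Finset.mem_coe, Finset.mem_attach, true_and]
    constructor
    · rintro ⟨_, ⟨s, rfl⟩, rfl⟩
      exact s.2
    · exact fun hx => ⟨⟨x, hSE x hx⟩, ⟨⟨x, hx⟩, rfl⟩, rfl⟩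

end Assembly

section Main

/-- The data of a symbol decomposition over `L`, realized inside an algebraically closed field:
a matrix algebra over `A` is split by `L` and few `p`-th roots of elements of `F`. -/
theorem exists_splitting_of_symbolLengthLE {p : ℕ} [hp : Fact p.Prime] {F L Ω A : Type} [Field F]
    [Field L] [CharP L p] [Algebra F L] [Field Ω] [Algebra F Ω] [Algebra L Ω]
    [IsScalarTower F L Ω] [CharP Ω p] (hperf : ∀ x : Ω, ∃ y, y ^ p = x) [Ring A] [Algebra F A]
    {σ : Ω →ₐ[F] Ω} {ω : Fin p → Ω}
    (hframe : IsCyclicFrame p (IsScalarTower.toAlgHom F L Ω).fieldRange σ ω) {n : ℕ}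
    (h : SymbolLengthLE p L (L ⊗[F] A) n) :
    ∃ (r d : ℕ) (S : Finset Ω), 0 < r ∧ 0 < d ∧
      d ^ 2 = Module.finrank F (Matrix (Fin r) (Fin r) A) ∧ S.card ≤ n * p ∧
      (∀ s ∈ S, s ∈ rootField p (⊥ : IntermediateField F Ω)) ∧
      ∃ φ : Matrix (Fin r) (Fin r) A →ₐ[F] Matrix (Fin d) (Fin d) Ω, ∀ a,
        φ a ∈ ((IsScalarTower.toAlgHom F L Ω).fieldRange ⊔
          IntermediateField.adjoin F (S : Set Ω)).toSubalgebra.matrix := by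
  classical
  obtain ⟨k, hkn, D, _, _, hD, r, s, hr, hs, ⟨e⟩⟩ := h
  choose a b hab using hD
  set L' := (IsScalarTower.toAlgHom F L Ω).fieldRange with hL'
  choose β hβ using fun i => hperf (algebraMap L Ω (b i))
  have hβL (i) : β i ∈ rootField p L' := by
    rw [mem_rootField, hβ]
    exact ⟨b i, rfl⟩
  choose c hc hβc using fun i => hframe.exists_coeff hperf (hβL i)
  let S : Finset Ω := Finset.univ.image fun q : Fin k × Fin p => c q.1 q.2
  let K := IntermediateField.adjoin F (S : Set Ω)
  have hcK (i j) : c i j ∈ K := IntermediateField.subset_adjoin F _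
    (Finset.mem_coe.2 (Finset.mem_image_of_mem _ (Finset.mem_univ (i, j))))
  let E : IntermediateField L Ω := (L' ⊔ K).toSubfield.toIntermediateField
    fun x => le_sup_left (a := L') ⟨x, rfl⟩
  have hβE (i) : β i ∈ E := by
    rw [hβc i]
    exact sum_mem fun j _ => mul_mem (le_sup_right (a := L') (hcK i j))
      (le_sup_left (a := L') (hframe.gen_mem j))
  have hsplit (i) : Nonempty (D i →ₐ[L] Matrix (Fin p) (Fin p) E) :=
    (hab i).exists_algHom_matrix ⟨β i, hβE i⟩ (Subtype.ext (hβ i))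
  obtain ⟨Φ⟩ := nonempty_piTensor_algHom_matrix D fun i => (hsplit i).some
  have hcard : Fintype.card (Fin s × (Fin k → Fin p)) = s * p ^ k := by simp
  let ε : Fin s × (Fin k → Fin p) ≃ Fin (s * p ^ k) := Fintype.equivFinOfCardEq hcard
  let Ψ : Matrix (Fin r) (Fin r) (L ⊗[F] A) →ₐ[L] Matrix (Fin (s * p ^ k)) (Fin (s * p ^ k)) Ω :=
    E.val.mapMatrix.comp (((Matrix.reindexAlgEquiv L E ε).toAlgHom.comp
      (Matrix.compAlgEquiv (Fin s) (Fin k → Fin p) E L).toAlgHom).comp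
        (Φ.mapMatrix.comp e.toAlgHom))
  have hΨ (x i j) : Ψ x i j ∈ L' ⊔ K := Subtype.prop (p := (· ∈ E)) _
  refine ⟨r, s * p ^ k, S, hr, Nat.mul_pos hs (pow_pos hp.out.pos k), ?_, ?_, ?_,
    (Ψ.restrictScalars F).comp
      (Algebra.TensorProduct.includeRight : A →ₐ[F] L ⊗[F] A).mapMatrix, fun x i j => hΨ _ i j⟩
  · have hfin (i) : FiniteDimensional L (D i) := Module.finite_of_finrank_pos
      (by rw [(hab i).2.1]; exact pow_pos hp.out.pos 2)
    have h1 := e.toLinearEquiv.finrank_eq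
    rw [Module.finrank_matrix, Module.finrank_matrix, finrank_piTensor,
      Module.finrank_baseChange] at h1
    rw [Module.finrank_matrix, h1, Finset.prod_congr rfl fun i _ => (hab i).2.1]
    simp only [Fintype.card_fin, Finset.prod_const, Finset.card_univ]
    ring
  · refine Finset.card_image_le.trans ?_
    rw [Finset.card_univ, Fintype.card_prod, Fintype.card_fin, Fintype.card_fin]
    exact Nat.mul_le_mul_right p hkn
  · intro x hx
    obtain ⟨q, _, rfl⟩ := Finset.mem_image.1 hx
    exact hc q.1 q.2

theorem symbolLengthLE_of_symbolLengthLE_cyclic {p : ℕ} [hp : Fact p.Prime] {F A L : Type}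
    [Field F] [CharP F p] [Ring A] [Algebra F A] (hA : IsCSA F A)
    (hsplit : IsSplitAlg F (⨂[F] _ : Fin p, A)) [Field L] [Algebra F L] [IsGalois F L]
    (hcyc : IsCyclic (L ≃ₐ[F] L)) (hLd : Module.finrank F L = p) {n : ℕ}
    (h : SymbolLengthLE p L (L ⊗[F] A) n) : SymbolLengthLE p F A ((n + 1) * p - 1) := by
  classical
  let Ω := AlgebraicClosure L
  have : CharP L p := charP_of_injective_algebraMap (algebraMap F L).injective p
  have : CharP Ω p := charP_of_injective_algebraMap (algebraMap L Ω).injective p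
  have hperf (x : Ω) : ∃ y, y ^ p = x := IsAlgClosed.exists_pow_nat_eq x hp.out.pos
  obtain ⟨σ, ω, hframe⟩ := exists_isCyclicFrame (Ω := Ω) hcyc hLd
  obtain ⟨r, d, S, hr, hd, hdim, hcard, hS, φ₁, h₁⟩ :=
    exists_splitting_of_symbolLengthLE hperf hframe h
  obtain ⟨θ, hθ⟩ := exists_ringEquiv_rootField_bot (F := F) hperf
  obtain ⟨m, hm, ⟨φ⟩⟩ := exists_algHom_matrix_of_split_power hA hsplit θ hθ
  have hmd : Fintype.card (Fin r × Fin m) = d := by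
    rw [Fintype.card_prod, Fintype.card_fin, Fintype.card_fin]
    refine Nat.pow_left_injective (n := 2) two_ne_zero ?_
    change (r * m) ^ 2 = d ^ 2
    rw [hdim, Module.finrank_matrix, Fintype.card_fin, ← hm]
    ring
  let R := rootField p (⊥ : IntermediateField F Ω)
  let φ₂ : Matrix (Fin r) (Fin r) A →ₐ[F] Matrix (Fin d) (Fin d) Ω :=
    R.val.mapMatrix.comp (((Matrix.reindexAlgEquiv F R (Fintype.equivFinOfCardEq hmd)).toAlgHom.comp
      (Matrix.compAlgEquiv (Fin r) (Fin m) R F).toAlgHom).comp φ.mapMatrix)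
  have h₂ (x) : φ₂ x ∈ R.toSubalgebra.matrix := mapMatrix_val_mem R _
  have hA' := hA.matrix hr
  obtain ⟨_, _, _⟩ := id hA'
  have : IsAzumaya F (Matrix (Fin r) (Fin r) A) := isAzumaya_of_central_simple F _
  have : Nonempty (Fin d) := ⟨⟨0, hd⟩⟩
  have hdim' : Fintype.card (Fin d) ^ 2 = Module.finrank F (Matrix (Fin r) (Fin r) A) := by
    rw [Fintype.card_fin, hdim]
  obtain ⟨T, hTcard, hT, ψ, hψ⟩ := hframe.exists_descent hperf
    (IntermediateField.adjoin_le_iff.2 hS) hdim' φ₁ φ₂ h₁ h₂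
  rw [← IntermediateField.adjoin_union, ← Finset.coe_union] at hψ
  refine ((symbolLengthLE_of_mem_matrix hA' hdim' (S ∪ T) (fun s hs => ?_) ψ hψ).mono ?_).of_matrix hr
  · exact (Finset.mem_union.1 hs).elim (hS s) (hT s)
  · refine (Finset.card_union_le S T).trans ?_
    have := hp.out.pos
    rw [add_mul, one_mul]
    omega

end Main

/-- If `A` is central simple of exponent `p` over `F` of characteristic `p`,
`L/F` is a cyclic extension of degree `p`, and `λ_p(A_L) ≤ n`, then
`λ_p(A) ≤ (n + 1) * p - 1`. -/
theorem statement11 (p : ℕ) (hp : p.Prime) (F : Type) [Field F] [CharP F p]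
    (A : Type) [Ring A] [Algebra F A] (hA : IsCSA F A) (hexp : HasExponent F A p)
    (L : Type) [Field L] [Algebra F L] [IsGalois F L]
    (hcyc : IsCyclic (L ≃ₐ[F] L)) (hLd : Module.finrank F L = p)
    (n : ℕ) (h : SymbolLengthLE p L (L ⊗[F] A) n) :
    SymbolLengthLE p F A ((n + 1) * p - 1) := by
  have : Fact p.Prime := ⟨hp⟩
  exact symbolLengthLE_of_symbolLengthLE_cyclic hA hexp.2.1 hcyc hLd h
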